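/- For every integer ℓ ≥ 2 there exists a 1-gap-planar simple graph G with exactly n = 16ℓ − 7 vertices such that cr_{1-gap}(G) ≥ ℓ and cr(G) ≤ 6; moreover the 1-gap-planar crossing ratio is Θ(n). -/

import Mathlib

open Set

noncomputable section

/-- A drawing of a simple graph in the plane: vertices are mapped to distinct
points, each edge `uv` is drawn as a simple arc joining the images of `u` and
`v` and avoiding the images of the other vertices, any two arcs meet in
finitely many points, and no three arcs pass through a common non-vertex
point. -/
structure Drawing {V : Type} (G : SimpleGraph V) where
  vpos : V → ℝ × ℝ
  vpos_inj : Function.Injective vpos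
  arc : V → V → ℝ → ℝ × ℝ
  arc_symm : ∀ u v t, arc u v t = arc v u (1 - t)
  arc_cont : ∀ u v, G.Adj u v → ContinuousOn (arc u v) (Set.Icc 0 1)
  arc_injOn : ∀ u v, G.Adj u v → Set.InjOn (arc u v) (Set.Icc 0 1)
  arc_start : ∀ u v, G.Adj u v → arc u v 0 = vpos u
  arc_end : ∀ u v, G.Adj u v → arc u v 1 = vpos v
  arc_avoids : ∀ u v, G.Adj u v → ∀ t ∈ Set.Ioo (0:ℝ) 1, arc u v t ∉ Set.range vpos
  inter_finite : ∀ u v w z, G.Adj u v → G.Adj w z → s(u, v) ≠ s(w, z) →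
    ((arc u v '' Set.Icc 0 1) ∩ (arc w z '' Set.Icc 0 1)).Finite
  no_triple_point : ∀ p : ℝ × ℝ, p ∉ Set.range vpos →
    ∀ u₁ v₁ u₂ v₂ u₃ v₃, G.Adj u₁ v₁ → G.Adj u₂ v₂ → G.Adj u₃ v₃ →
      s(u₁, v₁) ≠ s(u₂, v₂) → s(u₁, v₁) ≠ s(u₃, v₃) → s(u₂, v₂) ≠ s(u₃, v₃) →
      ¬ (p ∈ arc u₁ v₁ '' Set.Icc 0 1 ∧ p ∈ arc u₂ v₂ '' Set.Icc 0 1 ∧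
          p ∈ arc u₃ v₃ '' Set.Icc 0 1)

namespace Drawing

variable {V : Type} {G : SimpleGraph V}

lemma img_symm_aux (Γ : Drawing G) (u v : V) :
    Γ.arc u v '' Set.Icc 0 1 = Γ.arc v u '' Set.Icc 0 1 := by
  have key : ∀ a b : V, Γ.arc a b '' Set.Icc 0 1 ⊆ Γ.arc b a '' Set.Icc 0 1 := by
    rintro a b p ⟨t, ht, rfl⟩
    refine ⟨1 - t, ⟨by linarith [ht.2], by linarith [ht.1]⟩, ?_⟩
    rw [Γ.arc_symm b a (1 - t)]
    congr 1
    ring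
  exact Set.Subset.antisymm (key u v) (key v u)

/-- The image (trace) of an edge in the drawing. -/
def img (Γ : Drawing G) (e : Sym2 V) : Set (ℝ × ℝ) :=
  Sym2.lift ⟨fun u v => Γ.arc u v '' Set.Icc 0 1, fun u v => Γ.img_symm_aux u v⟩ e

/-- `p` is a crossing point of the two distinct edges `e` and `f` : it lies on
both arcs and is not the image of a vertex (so it is not a shared endpoint). -/
def Crossing (Γ : Drawing G) (e f : Sym2 V) (p : ℝ × ℝ) : Prop :=
  e ∈ G.edgeSet ∧ f ∈ G.edgeSet ∧ e ≠ f ∧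
    p ∈ Γ.img e ∧ p ∈ Γ.img f ∧ p ∉ Set.range Γ.vpos

/-- The edges `e` and `f` cross in the drawing. -/
def Crosses (Γ : Drawing G) (e f : Sym2 V) : Prop := ∃ p, Γ.Crossing e f p

/-- The set of crossing points of a drawing. -/
def crossingSet (Γ : Drawing G) : Set (ℝ × ℝ) := {p | ∃ e f, Γ.Crossing e f p}

/-- The number of crossings of a drawing. -/
def crossings (Γ : Drawing G) : ℕ := Γ.crossingSet.ncard

/-- The set of crossing points lying on a given edge. -/
def edgeCrossings (Γ : Drawing G) (e : Sym2 V) : Set (ℝ × ℝ) :=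
  {p | ∃ f, Γ.Crossing e f p}

/-- A drawing is `k`-planar if every edge is involved in at most `k` crossings. -/
def IsKPlanar (Γ : Drawing G) (k : ℕ) : Prop :=
  ∀ e ∈ G.edgeSet, (Γ.edgeCrossings e).ncard ≤ k

/-- A drawing is `k`-gap-planar if each crossing can be assigned to one of its
two involved edges such that every edge is assigned at most `k` crossings. -/
def IsKGapPlanar (Γ : Drawing G) (k : ℕ) : Prop :=
  ∃ assign : ℝ × ℝ → Sym2 V,
    (∀ p ∈ Γ.crossingSet, ∃ f, Γ.Crossing (assign p) f p) ∧
    ∀ e : Sym2 V, {p | p ∈ Γ.crossingSet ∧ assign p = e}.ncard ≤ k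

/-- A drawing is skewness-`k` if there is a set of at most `k` edges such that
every crossing involves an edge from the set. -/
def IsSkewness (Γ : Drawing G) (k : ℕ) : Prop :=
  ∃ S : Finset (Sym2 V), S.card ≤ k ∧
    ∀ p ∈ Γ.crossingSet, ∃ e ∈ S, ∃ f, Γ.Crossing e f p

/-- A drawing is `k`-apex if there is a set of at most `k` vertices such that
every crossing involves an edge incident to one of these vertices. -/
def IsKApex (Γ : Drawing G) (k : ℕ) : Prop :=
  ∃ S : Finset V, S.card ≤ k ∧
    ∀ p ∈ Γ.crossingSet, ∃ e f, Γ.Crossing e f p ∧ ∃ a ∈ S, a ∈ e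

/-- A drawing is `(k,l)`-grid-free if there is no set of `k` edges each of
which crosses each edge of some set of `l` edges. -/
def IsGridFree (Γ : Drawing G) (k l : ℕ) : Prop :=
  ¬ ∃ A B : Finset (Sym2 V), A.card = k ∧ B.card = l ∧
      ∀ e ∈ A, ∀ f ∈ B, Γ.Crosses e f

/-- A drawing is `k`-fan-crossing-free if no edge crosses `k` edges that all
share a common endpoint. -/
def IsKFanCrossingFree (Γ : Drawing G) (k : ℕ) : Prop :=
  ¬ ∃ (e : Sym2 V) (a : V) (F : Finset (Sym2 V)), F.card = k ∧
      ∀ f ∈ F, a ∈ f ∧ Γ.Crosses e f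

/-- A drawing is planarly connected if for any two crossing edges, two of
their endpoints are joined by a crossing-free edge. -/
def IsPlanarlyConnected (Γ : Drawing G) : Prop :=
  ∀ e f : Sym2 V, Γ.Crosses e f →
    ∃ a b : V, a ∈ e ∧ b ∈ f ∧ G.Adj a b ∧ Γ.edgeCrossings s(a, b) = ∅

/-- A drawing is straight-line if every edge is drawn as the line segment
between the images of its endpoints. -/
def IsStraight (Γ : Drawing G) : Prop :=
  ∀ u v : V, G.Adj u v → ∀ t ∈ Set.Icc (0:ℝ) 1,
    Γ.arc u v t = (1 - t) • Γ.vpos u + t • Γ.vpos v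

/-- A straight-line RAC drawing: straight-line and any two crossing edges are
perpendicular. -/
def IsRAC (Γ : Drawing G) : Prop :=
  Γ.IsStraight ∧
    ∀ u v w z : V, G.Adj u v → G.Adj w z → Γ.Crosses s(u, v) s(w, z) →
      (Γ.vpos v - Γ.vpos u).1 * (Γ.vpos z - Γ.vpos w).1 +
        (Γ.vpos v - Γ.vpos u).2 * (Γ.vpos z - Γ.vpos w).2 = 0

end Drawing

/-- The crossing number of `G`: the minimum number of crossings over all
drawings of `G`. -/
def crNum {V : Type} (G : SimpleGraph V) : ℕ :=
  sInf {n | ∃ Γ : Drawing G, Γ.crossings = n}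

/-- The crossing number of `G` restricted to drawings satisfying `P`. -/
def crNumRestricted {V : Type} (G : SimpleGraph V) (P : Drawing G → Prop) : ℕ :=
  sInf {n | ∃ Γ : Drawing G, P Γ ∧ Γ.crossings = n}

/-- The rectilinear crossing number of `G`. -/
def rectCrNum {V : Type} (G : SimpleGraph V) : ℕ :=
  crNumRestricted G (fun Γ => Γ.IsStraight)

/-- An ℓ₂-bundle between `x` and `y`: `P` is the set of the internal vertices
of ℓ internally disjoint paths of length two from `x` to `y`, all of whose
internal vertices have degree exactly two in `G` (here ℓ = `P.card`). -/
def IsL2Bundle {V : Type} (G : SimpleGraph V) (x y : V) (P : Finset V) : Prop :=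
  x ≠ y ∧ x ∉ P ∧ y ∉ P ∧
    ∀ p ∈ P, G.Adj x p ∧ G.Adj p y ∧ (G.neighborSet p).ncard = 2

/-- Two drawings of `G` are weakly isomorphic: there is an incidence-preserving
one-to-one correspondence of vertices and edges that preserves crossings. -/
def WeaklyIso {V : Type} {G : SimpleGraph V} (Γ Γ' : Drawing G) : Prop :=
  ∃ φ : G ≃g G, ∀ e f : Sym2 V,
    Γ.Crosses e f ↔ Γ'.Crosses (Sym2.map (fun a => φ a) e) (Sym2.map (fun a => φ a) f)

lemma exists_continuous_log {X : Type} [TopologicalSpace X] [SimplyConnectedSpace X]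
    [LocallyPathConnectedSpace X] {g : X → ℂ} (hg : Continuous g) (h0 : ∀ x, g x ≠ 0) :
    ∃ L : X → ℂ, Continuous L ∧ ∀ x, Complex.exp (L x) = g x := by
  have x₀ : X := Classical.arbitrary X
  obtain ⟨f, ⟨-, hf⟩, -⟩ := Complex.isCoveringMapOn_exp.existsUnique_continuousMap_lifts
    ⟨g, hg⟩ (Complex.exp_log (h0 x₀)) (fun x => h0 x)
  exact ⟨f, f.continuous, fun x => congrFun hf x⟩

lemma log_variation_unique {L M : ℝ → ℂ} (hL : Continuous L) (hM : Continuous M)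
    (h : ∀ x, Complex.exp (L x) = Complex.exp (M x)) : L 1 - L 0 = M 1 - M 0 := by
  have hcov := Complex.isCoveringMap_exp
  have key : L = fun x => M x + (L 0 - M 0) := by
    refine hcov.eq_of_comp_eq hL (by fun_prop) ?_ 0 (by ring)
    funext x
    apply Subtype.ext
    change Complex.exp (L x) = Complex.exp (M x + (L 0 - M 0))
    rw [Complex.exp_add, Complex.exp_sub, h x, h 0, div_self (Complex.exp_ne_zero _), mul_one]
  have := congrFun key 1
  rw [this]; ring

/-- The signed turning equations of the nine edges of `K₃,₃` in the plane are inconsistent. -/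
lemma k33_parity (nA nB : Fin 3 → Fin 3 → Fin 3 → ℤ)
    (h₁ : ∀ i i' j j', i < i' → j < j' →
      1 + nA i' i j + nB j i' j' - nA i i' j' - nB j' i j = 0)
    (h₂ : ∀ i i' j j', i < i' → j' < j →
      nA i' i j + nB j i' j' - nA i i' j' - nB j' i j = 0) : False := by
  have a1 := h₁ 0 1 0 1 (by decide) (by decide)
  have a2 := h₁ 0 1 0 2 (by decide) (by decide)
  have a3 := h₁ 0 1 1 2 (by decide) (by decide)
  have a4 := h₁ 0 2 0 1 (by decide) (by decide)
  have a5 := h₁ 0 2 0 2 (by decide) (by decide)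
  have a6 := h₁ 0 2 1 2 (by decide) (by decide)
  have a7 := h₁ 1 2 0 1 (by decide) (by decide)
  have a8 := h₁ 1 2 0 2 (by decide) (by decide)
  have a9 := h₁ 1 2 1 2 (by decide) (by decide)
  have b1 := h₂ 0 1 1 0 (by decide) (by decide)
  have b2 := h₂ 0 1 2 0 (by decide) (by decide)
  have b3 := h₂ 0 1 2 1 (by decide) (by decide)
  have b4 := h₂ 0 2 1 0 (by decide) (by decide)
  have b5 := h₂ 0 2 2 0 (by decide) (by decide)
  have b6 := h₂ 0 2 2 1 (by decide) (by decide)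
  have b7 := h₂ 1 2 1 0 (by decide) (by decide)
  have b8 := h₂ 1 2 2 0 (by decide) (by decide)
  have b9 := h₂ 1 2 2 1 (by decide) (by decide)
  have := congrArg₂ (· + ·) (congrArg₂ (· + ·) (congrArg₂ (· + ·) (congrArg₂ (· + ·) a1 a2)
    (congrArg₂ (· + ·) a3 a4)) (congrArg₂ (· + ·) (congrArg₂ (· + ·) a5 a6)
    (congrArg₂ (· + ·) a7 a8))) (congrArg₂ (· + ·) (congrArg₂ (· + ·) a9 b1)
    (congrArg₂ (· + ·) (congrArg₂ (· + ·) (congrArg₂ (· + ·) b2 b3) (congrArg₂ (· + ·) b4 b5))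
    (congrArg₂ (· + ·) (congrArg₂ (· + ·) b6 b7) (congrArg₂ (· + ·) b8 b9))))
  omega

lemma square_log_variation {e f : ℝ → ℂ} (he : Continuous e) (hf : Continuous f)
    (hne : ∀ s t, e s ≠ f t) {P Q R S : ℝ → ℂ} (hP : Continuous P) (hQ : Continuous Q)
    (hR : Continuous R) (hS : Continuous S)
    (eP : ∀ s, Complex.exp (P s) = e s - f 0) (eQ : ∀ t, Complex.exp (Q t) = f t - e 1)
    (eR : ∀ s, Complex.exp (R s) = e s - f 1) (eS : ∀ t, Complex.exp (S t) = f t - e 0) :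
    (P 1 - P 0) + (Q 1 - Q 0) = (S 1 - S 0) + (R 1 - R 0) := by
  obtain ⟨L, hL, eL⟩ := exists_continuous_log (X := ℝ × ℝ) (g := fun z => e z.1 - f z.2)
    (by fun_prop) (fun z => sub_ne_zero.2 (hne _ _))
  have neg : ∀ z : ℂ, Complex.exp (z + Real.pi * Complex.I) = - Complex.exp z := fun z => by
    rw [Complex.exp_add, Complex.exp_pi_mul_I]; ring
  have hp := log_variation_unique hP (M := fun s => L (s, 0)) (by fun_prop)
    (fun s => by rw [eP, eL])
  have hr := log_variation_unique hR (M := fun s => L (s, 1)) (by fun_prop)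
    (fun s => by rw [eR, eL])
  have hq := log_variation_unique hQ (M := fun t => L (1, t) + Real.pi * Complex.I) (by fun_prop)
    (fun s => by rw [eQ, neg, eL]; ring)
  have hs := log_variation_unique hS (M := fun t => L (0, t) + Real.pi * Complex.I) (by fun_prop)
    (fun s => by rw [eS, neg, eL]; ring)
  rw [hp, hq, hr, hs]; ring

lemma exists_log_difference {u v : ℂ} (h : Complex.exp u = Complex.exp v) :
    ∃ n : ℤ, u = v + n * (2 * Real.pi * Complex.I) :=
  Complex.exp_eq_exp_iff_exists_int.1 h

/-- Any nine paths joining three points to three points of the plane contain two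
paths without common endpoints that meet. -/
theorem k33_paths_meet {a b : Fin 3 → ℂ} (γ : ∀ i j, Path (a i) (b j)) :
    ∃ i i' j j' s t, i ≠ i' ∧ j ≠ j' ∧ γ i j s = γ i' j' t := by
  by_contra! H
  have neg : ∀ z : ℂ, Complex.exp (z + Real.pi * Complex.I) = - Complex.exp z := fun z => by
    rw [Complex.exp_add, Complex.exp_pi_mul_I]; ring
  set e : Fin 3 → Fin 3 → ℝ → ℂ := fun i j => (γ i j).extend with he_def
  have he : ∀ i j, Continuous (e i j) := fun i j => (γ i j).continuous_extend
  have e0 : ∀ i j, e i j 0 = a i := fun i j => (γ i j).extend_zero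
  have e1 : ∀ i j, e i j 1 = b j := fun i j => (γ i j).extend_one
  have hne : ∀ i i' j j' s t, i ≠ i' → j ≠ j' → e i j s ≠ e i' j' t := by
    intro i i' j j' s t hi hj
    exact H i i' j j' _ _ hi hj
  have exj : ∀ j : Fin 3, ∃ j', j ≠ j' := by decide
  have hab : ∀ i j, a i ≠ b j := by
    intro i j
    obtain ⟨i', hi⟩ := exj i
    obtain ⟨j', hj⟩ := exj j
    have := hne i i' j' j 0 1 hi hj.symm
    rwa [e0, e1] at this
  have haa : ∀ i i', i ≠ i' → a i ≠ a i' := by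
    intro i i' hi
    have := hne i i' 0 1 0 0 hi (by decide)
    rwa [e0, e0] at this
  have hbb : ∀ i i', i ≠ i' → b i ≠ b i' := by
    intro i i' hi
    have := hne 0 1 i i' 1 1 (by decide) hi
    rwa [e1, e1] at this
  have hA : ∀ i' i j, ∃ L : ℝ → ℂ, Continuous L ∧
      (i ≠ i' → ∀ s, Complex.exp (L s) = e i j s - a i') := by
    intro i' i j
    by_cases hi : i = i'
    · exact ⟨0, continuous_const, fun h => absurd hi h⟩
    obtain ⟨j', hj⟩ := exj j
    obtain ⟨L, hL, h⟩ := exists_continuous_log (g := fun s => e i j s - a i')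
      ((he i j).sub continuous_const) (fun s => sub_ne_zero.2 (by
        rw [← e0 i' j']; exact hne _ _ _ _ _ _ hi hj))
    exact ⟨L, hL, fun _ => h⟩
  have hB : ∀ j' i j, ∃ L : ℝ → ℂ, Continuous L ∧
      (j ≠ j' → ∀ s, Complex.exp (L s) = e i j s - b j') := by
    intro j' i j
    by_cases hj : j = j'
    · exact ⟨0, continuous_const, fun h => absurd hj h⟩
    obtain ⟨i', hi⟩ := exj i
    obtain ⟨L, hL, h⟩ := exists_continuous_log (g := fun s => e i j s - b j')
      ((he i j).sub continuous_const) (fun s => sub_ne_zero.2 (by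
        rw [← e1 i' j']; exact hne _ _ _ _ _ _ hi hj))
    exact ⟨L, hL, fun _ => h⟩
  choose LA cA eA using hA
  choose LB cB eB using hB
  have ordered_logs : ∀ p : Fin 3 → ℂ, (∀ i i', i ≠ i' → p i ≠ p i') →
      ∃ l : Fin 3 → Fin 3 → ℂ, (∀ i i', i ≠ i' → Complex.exp (l i i') = p i - p i') ∧
        ∀ i i', i < i' → l i' i = l i i' + Real.pi * Complex.I := by
    intro p hp
    refine ⟨fun i i' => if i < i' then Complex.log (p i - p i')
      else Complex.log (p i' - p i) + Real.pi * Complex.I, ?_, ?_⟩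
    · intro i i' hi
      dsimp only
      split_ifs
      · exact Complex.exp_log (sub_ne_zero.2 (hp _ _ hi))
      · rw [neg, Complex.exp_log (sub_ne_zero.2 (hp _ _ hi.symm))]; ring
    · intro i i' hi
      dsimp only
      rw [if_neg hi.le.not_gt, if_pos hi]
  obtain ⟨la, ela, la'⟩ := ordered_logs a haa
  obtain ⟨lb, elb, lb'⟩ := ordered_logs b hbb
  set l : Fin 3 → Fin 3 → ℂ := fun i j => Complex.log (a i - b j) with hl
  have el : ∀ i j, Complex.exp (l i j) = a i - b j := fun i j =>
    Complex.exp_log (sub_ne_zero.2 (hab i j))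
  have hnA : ∀ i' i j, ∃ n : ℤ, i ≠ i' → LA i' i j 1 - LA i' i j 0 =
      l i' j + Real.pi * Complex.I - la i i' + n * (2 * Real.pi * Complex.I) := by
    intro i' i j
    by_cases hi : i = i'
    · exact ⟨0, fun h => absurd hi h⟩
    obtain ⟨n, hn⟩ := exists_log_difference (u := LA i' i j 1 - LA i' i j 0)
      (v := l i' j + Real.pi * Complex.I - la i i') (by
        rw [Complex.exp_sub, Complex.exp_sub, neg, eA _ _ _ hi, eA _ _ _ hi, e0, e1, el, ela _ _ hi]
        ring)
    exact ⟨n, fun _ => hn⟩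
  have hnB : ∀ j' i j, ∃ n : ℤ, j ≠ j' → LB j' i j 1 - LB j' i j 0 =
      lb j j' - l i j' + n * (2 * Real.pi * Complex.I) := by
    intro j' i j
    by_cases hj : j = j'
    · exact ⟨0, fun h => absurd hj h⟩
    obtain ⟨n, hn⟩ := exists_log_difference (u := LB j' i j 1 - LB j' i j 0)
      (v := lb j j' - l i j') (by
        rw [Complex.exp_sub, Complex.exp_sub, eB _ _ _ hj, eB _ _ _ hj, e0, e1, el, elb _ _ hj])
    exact ⟨n, fun _ => hn⟩
  choose nA hnA using hnA
  choose nB hnB using hnB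
  have square : ∀ i i' j j', i < i' → j ≠ j' →
      lb j' j - lb j j' + Real.pi * Complex.I +
        (nA i' i j + nB j i' j' - nA i i' j' - nB j' i j) * (2 * Real.pi * Complex.I) = 0 := by
    intro i i' j j' hi hj
    have h := square_log_variation (he i j) (he i' j')
      (fun s t => hne _ _ _ _ _ _ hi.ne hj) (cA i' i j) (cB j i' j') (cB j' i j) (cA i i' j')
      (by rw [e0]; exact eA _ _ _ hi.ne) (by rw [e1]; exact eB _ _ _ hj.symm)
      (by rw [e1]; exact eB _ _ _ hj) (by rw [e0]; exact eA _ _ _ hi.ne')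
    rw [hnA _ _ _ hi.ne, hnA _ _ _ hi.ne', hnB _ _ _ hj, hnB _ _ _ hj.symm, la' _ _ hi] at h
    linear_combination h
  have two_pi : (2 * Real.pi * Complex.I : ℂ) ≠ 0 := Complex.two_pi_I_ne_zero
  refine k33_parity nA nB ?_ ?_
  · intro i i' j j' hi hj
    have h := square i i' j j' hi hj.ne
    rw [lb' _ _ hj] at h
    have h' : ((1 + nA i' i j + nB j i' j' - nA i i' j' - nB j' i j : ℤ) : ℂ) *
        (2 * Real.pi * Complex.I) = 0 := by
      push_cast; linear_combination h
    exact_mod_cast (mul_eq_zero.1 h').resolve_right two_pi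
  · intro i i' j j' hi hj
    have h := square i i' j j' hi hj.ne'
    rw [lb' _ _ hj] at h
    have h' : ((nA i' i j + nB j i' j' - nA i i' j' - nB j' i j : ℤ) : ℂ) *
        (2 * Real.pi * Complex.I) = 0 := by
      push_cast; linear_combination h
    exact_mod_cast (mul_eq_zero.1 h').resolve_right two_pi

/-- Topological nonplanarity of `K₃,₃`. -/
theorem k33_joinedIn_meet {a b : Fin 3 → ℝ × ℝ} (F : Fin 3 → Fin 3 → Set (ℝ × ℝ))
    (h : ∀ i j, JoinedIn (F i j) (a i) (b j)) :
    ∃ i i' j j', i ≠ i' ∧ j ≠ j' ∧ (F i j ∩ F i' j').Nonempty := by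
  have hc : Continuous Complex.equivRealProdCLM.symm := Complex.equivRealProdCLM.symm.continuous
  obtain ⟨i, i', j, j', s, t, hi, hj, hst⟩ :=
    k33_paths_meet fun i j => (h i j).somePath.map hc
  refine ⟨i, i', j, j', hi, hj, (h i j).somePath s, (h i j).somePath_mem s, ?_⟩
  have : (h i j).somePath s = (h i' j').somePath t :=
    Complex.equivRealProdCLM.symm.injective hst
  rw [this]
  exact (h i' j').somePath_mem t

section Mader

open Classical Finset

/-- Number of ordered pairs of `A`-related elements of a finite family. -/
def orderedPairs {α : Type*} (A : α → α → Prop) (R : Finset α) : ℕ :=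
  ∑ X ∈ R, #{Y ∈ R | A X Y}

lemma orderedPairs_insert {α : Type*} [DecidableEq α] {A : α → α → Prop} (hs : ∀ x y, A x y → A y x)
    (hi : ∀ x, ¬ A x x) {R : Finset α} {M : α} (hM : M ∉ R) :
    orderedPairs A (insert M R) = orderedPairs A R + 2 * #{Y ∈ R | A M Y} := by
  have h1 : ∀ X ∈ R, #{Y ∈ insert M R | A X Y} = #{Y ∈ R | A X Y} + if A M X then 1 else 0 := by
    intro X _
    rw [filter_insert]
    by_cases h : A M X
    · rw [if_pos (hs _ _ h), if_pos h, card_insert_of_notMem (by simp [hM])]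
    · rw [if_neg (fun h' => h (hs _ _ h')), if_neg h, add_zero]
  rw [orderedPairs, sum_insert hM, sum_congr rfl h1, sum_add_distrib, filter_insert,
    if_neg (hi M), ← card_filter, orderedPairs]
  ring

lemma orderedPairs_merge {α : Type*} [DecidableEq α] {A : α → α → Prop} (hs : ∀ x y, A x y → A y x)
    (hi : ∀ x, ¬ A x x) {R : Finset α} {B B' M : α} (hB : B ∉ R) (hB' : B' ∉ R) (hM : M ∉ R)
    (hBB' : A B B') (hMY : ∀ Y ∈ R, A M Y ↔ A B Y ∨ A B' Y) :
    orderedPairs A (insert B (insert B' R)) =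
      orderedPairs A (insert M R) + 2 + 2 * #{Y ∈ R | A B Y ∧ A B' Y} := by
  have hne : B ≠ B' := fun h => hi B (by rw [← h] at hBB'; exact hBB')
  rw [orderedPairs_insert hs hi (by simp [hB, hne]), orderedPairs_insert hs hi hB',
    orderedPairs_insert hs hi hM, filter_insert, if_pos hBB', card_insert_of_notMem (by simp [hB']),
    filter_congr hMY]
  have := card_union_add_card_inter {Y ∈ R | A B Y} {Y ∈ R | A B' Y}
  rw [← filter_or, ← filter_and] at this
  omega

variable {V : Type*}

/-- Two distinct vertex sets joined by an edge. -/
def Touch (G : SimpleGraph V) (X Y : Finset V) : Prop :=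
  X ≠ Y ∧ ∃ x ∈ X, ∃ y ∈ Y, G.Adj x y

lemma Touch.symm {G : SimpleGraph V} {X Y : Finset V} (h : Touch G X Y) : Touch G Y X := by
  obtain ⟨h, x, hx, y, hy, hxy⟩ := h
  exact ⟨h.symm, y, hy, x, hx, hxy.symm⟩

/-- Mader's theorem: a family of disjoint connected vertex sets with many touching pairs
contains a clique minor each of whose branch sets includes a member of the family. -/
theorem exists_clique_minor (G : SimpleGraph V) (r : ℕ) : ∀ (N : ℕ) (𝓑 : Finset (Finset V)),
    #𝓑 = N → 𝓑.Nonempty → (∀ X ∈ 𝓑, ∀ Y ∈ 𝓑, X ≠ Y → Disjoint X Y) →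
    (∀ X ∈ 𝓑, (G.induce (X : Set V)).Connected) →
    (2 ^ r - 1) * #𝓑 ≤ orderedPairs (Touch G) 𝓑 →
    ∃ C : Fin (r + 1) → Finset V,
      (∀ i j, i ≠ j → Disjoint (C i) (C j)) ∧
      (∀ i, (G.induce (C i : Set V)).Connected) ∧
      (∀ i j, i ≠ j → ∃ x ∈ C i, ∃ y ∈ C j, G.Adj x y) ∧
      (∀ i, C i ⊆ 𝓑.biUnion id) ∧ (∀ i, ∃ X ∈ 𝓑, X ⊆ C i) := by
  induction r with
  | zero =>
    rintro N 𝓑 - ⟨X, hX⟩ - hconn -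
    refine ⟨fun _ => X, ?_, fun _ => hconn X hX, ?_, fun _ => ?_, fun _ => ⟨X, hX, subset_rfl⟩⟩
    · intro i j h; exact absurd (by omega) h
    · intro i j h; exact absurd (by omega) h
    · intro v hv; exact mem_biUnion.2 ⟨X, hX, hv⟩
  | succ r ih =>
    intro N
    induction N using Nat.strong_induction_on with
    | _ N ihN =>
    intro 𝓑 hN hne hdisj hconn hcard
    by_cases hmerge : ∃ B ∈ 𝓑, ∃ B' ∈ 𝓑, Touch G B B' ∧
        2 + 2 * #{Y ∈ (𝓑.erase B).erase B' | Touch G B Y ∧ Touch G B' Y} ≤ 2 ^ (r + 1) - 1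
    · obtain ⟨B, hB, B', hB', ht, hcom⟩ := hmerge
      set R := (𝓑.erase B).erase B' with hR
      have hBR : B ∉ R := by simp [hR]
      have hBR' : B' ∉ R := by simp [hR]
      have hRsub : R ⊆ 𝓑 := (erase_subset _ _).trans (erase_subset _ _)
      have h𝓑 : 𝓑 = insert B (insert B' R) := by
        rw [hR, insert_erase (mem_erase.2 ⟨ht.1.symm, hB'⟩), insert_erase hB]
      obtain ⟨hBne, x, hx, y, hy, hxy⟩ := id ht
      have hMdisj : ∀ Y ∈ R, Disjoint (B ∪ B') Y := by
        intro Y hY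
        rw [Finset.disjoint_union_left]
        exact ⟨hdisj B hB Y (hRsub hY) (fun h => hBR (h ▸ hY)),
          hdisj B' hB' Y (hRsub hY) (fun h => hBR' (h ▸ hY))⟩
      have hMR : B ∪ B' ∉ R := fun h => by
        have := disjoint_self.1 (hMdisj _ h)
        have hx' : x ∈ B ∪ B' := Finset.mem_union_left _ hx
        rw [this] at hx'
        exact absurd hx' (notMem_empty _)
      have hcount := orderedPairs_merge (A := Touch G) (fun _ _ h => h.symm) (fun _ h => h.1 rfl)
        hBR hBR' hMR ht (fun Y hY => by
          have h1 : B ≠ Y := fun h => hBR (h ▸ hY)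
          have h2 : B' ≠ Y := fun h => hBR' (h ▸ hY)
          have h3 : B ∪ B' ≠ Y := fun h => hMR (h ▸ hY)
          simp only [Touch, Finset.mem_union]
          constructor
          · rintro ⟨-, u, hu | hu, hv⟩
            · exact Or.inl ⟨h1, u, hu, hv⟩
            · exact Or.inr ⟨h2, u, hu, hv⟩
          · rintro (⟨-, u, hu, hv⟩ | ⟨-, u, hu, hv⟩)
            · exact ⟨h3, u, Or.inl hu, hv⟩
            · exact ⟨h3, u, Or.inr hu, hv⟩)
      have hc1 : #𝓑 = #R + 2 := by
        rw [congrArg Finset.card h𝓑, card_insert_of_notMem (by simp [hBR, hBne]), card_insert_of_notMem hBR']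
      have hc2 : #(insert (B ∪ B') R) = #R + 1 := card_insert_of_notMem hMR
      obtain ⟨C, c1, c2, c3, c4, c5⟩ := ihN (#R + 1) (by omega) (insert (B ∪ B') R) hc2
        (insert_nonempty _ _) (by
          intro X hX Y hY hXY
          rcases mem_insert.1 hX with rfl | hX <;> rcases mem_insert.1 hY with rfl | hY
          · exact absurd rfl hXY
          · exact hMdisj _ hY
          · exact (hMdisj _ hX).symm
          · exact hdisj _ (hRsub hX) _ (hRsub hY) hXY)
        (by
          intro X hX
          rcases mem_insert.1 hX with rfl | hX
          · rw [coe_union]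
            exact SimpleGraph.connected_induce_union (hconn B hB).preconnected
              (hconn B' hB').preconnected hx hy hxy
          · exact hconn _ (hRsub hX))
        (by
          rw [hc2]
          have : (2 ^ (r + 1) - 1) * #𝓑 = (2 ^ (r + 1) - 1) * (#R + 1) + (2 ^ (r + 1) - 1) := by
            rw [hc1]; ring
          have h𝓑' := congrArg (orderedPairs (Touch G)) h𝓑
          omega)
      refine ⟨C, c1, c2, c3, fun i v hv => ?_, fun i => ?_⟩
      · obtain ⟨X, hX, hvX⟩ := mem_biUnion.1 (c4 i hv)
        rcases mem_insert.1 hX with rfl | hX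
        · rcases Finset.mem_union.1 hvX with h | h
          · exact mem_biUnion.2 ⟨B, hB, h⟩
          · exact mem_biUnion.2 ⟨B', hB', h⟩
        · exact mem_biUnion.2 ⟨X, hRsub hX, hvX⟩
      · obtain ⟨X, hX, hXC⟩ := c5 i
        rcases mem_insert.1 hX with rfl | hX
        · exact ⟨B, hB, subset_union_left.trans hXC⟩
        · exact ⟨X, hRsub hX, hXC⟩
    · push Not at hmerge
      have hpow : 1 ≤ 2 ^ r := Nat.one_le_two_pow
      have hpow' : 2 ^ (r + 1) = 2 * 2 ^ r := by ring
      have hpos : 0 < orderedPairs (Touch G) 𝓑 := by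
        refine lt_of_lt_of_le ?_ hcard
        exact Nat.mul_pos (by omega) (card_pos.2 hne)
      obtain ⟨B, hB, hBpos⟩ : ∃ B ∈ 𝓑, 0 < #{Y ∈ 𝓑 | Touch G B Y} := by
        by_contra! h
        exact hpos.ne' (sum_eq_zero fun X hX => Nat.le_zero.1 (h X hX))
      set N' := {Y ∈ 𝓑 | Touch G B Y} with hN'
      have hsub : N' ⊆ 𝓑 := filter_subset _ _
      obtain ⟨C, c1, c2, c3, c4, c5⟩ := ih #N' N' rfl (card_pos.1 hBpos)
        (fun X hX Y hY => hdisj X (hsub hX) Y (hsub hY)) (fun X hX => hconn X (hsub hX)) (by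
          rw [mul_comm, ← smul_eq_mul, ← sum_const]
          refine sum_le_sum fun X hX => ?_
          obtain ⟨hX𝓑, hBX⟩ := mem_filter.1 hX
          have h := hmerge B hB X hX𝓑 hBX
          have : #{Y ∈ (𝓑.erase B).erase X | Touch G B Y ∧ Touch G X Y} ≤
              #{Y ∈ N' | Touch G X Y} := by
            refine card_le_card fun Y hY => ?_
            simp only [mem_filter, mem_erase, hN'] at hY ⊢
            exact ⟨⟨hY.1.2.2, hY.2.1⟩, hY.2.2⟩
          omega)
      have hBC : ∀ i, Disjoint B (C i) := by
        intro i
        rw [Finset.disjoint_left]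
        intro v hvB hvC
        obtain ⟨X, hX, hvX⟩ := mem_biUnion.1 (c4 i hvC)
        have hX' := mem_filter.1 hX
        exact Finset.disjoint_left.1 (hdisj B hB X hX'.1 hX'.2.1) hvB hvX
      have hBadj : ∀ i, ∃ x ∈ B, ∃ y ∈ C i, G.Adj x y := by
        intro i
        obtain ⟨X, hX, hXC⟩ := c5 i
        obtain ⟨-, x, hx, y, hy, hxy⟩ := (mem_filter.1 hX).2
        exact ⟨x, hx, y, hXC hy, hxy⟩
      refine ⟨Fin.cons B C, ?_, ?_, ?_, ?_, ?_⟩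
      · intro i j
        refine Fin.cases ?_ (fun i => ?_) i <;> refine Fin.cases ?_ (fun j => ?_) j
        · intro h; exact absurd rfl h
        · intro _; simpa using hBC j
        · intro _; simpa using (hBC i).symm
        · intro h; simpa using c1 i j (fun h' => h (by rw [h']))
      · intro i
        refine Fin.cases ?_ (fun i => ?_) i
        · exact hconn B hB
        · exact c2 i
      · intro i j
        refine Fin.cases ?_ (fun i => ?_) i <;> refine Fin.cases ?_ (fun j => ?_) j
        · intro h; exact absurd rfl h
        · intro _; simpa using hBadj j
        · intro _
          obtain ⟨x, hx, y, hy, hxy⟩ := hBadj i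
          exact ⟨y, by simpa using hy, x, by simpa using hx, hxy.symm⟩
        · intro h; simpa using c3 i j (fun h' => h (by rw [h']))
      · intro i
        refine Fin.cases ?_ (fun i => ?_) i
        · intro v hv; exact mem_biUnion.2 ⟨B, hB, by simpa using hv⟩
        · intro v hv
          exact biUnion_subset_biUnion_of_subset_left id hsub (c4 i (by simpa using hv))
      · intro i
        refine Fin.cases ?_ (fun i => ?_) i
        · exact ⟨B, hB, by simp⟩
        · obtain ⟨X, hX, hXC⟩ := c5 i
          exact ⟨X, hsub hX, by simpa using hXC⟩

/-- A nonempty finite graph with average degree at least `2 ^ r - 1` has a clique minor on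
`r + 1` branch sets. -/
theorem exists_clique_minor_of_card_edges [Fintype V] [Nonempty V] (G : SimpleGraph V) (r : ℕ)
    (h : (2 ^ r - 1) * Fintype.card V ≤ 2 * #G.edgeFinset) :
    ∃ C : Fin (r + 1) → Finset V,
      (∀ i j, i ≠ j → Disjoint (C i) (C j)) ∧
      (∀ i, (G.induce (C i : Set V)).Connected) ∧
      (∀ i j, i ≠ j → ∃ x ∈ C i, ∃ y ∈ C j, G.Adj x y) := by
  have hcard : #(univ.map ⟨fun v : V => ({v} : Finset V), singleton_injective⟩) =
      Fintype.card V := by rw [card_map, card_univ]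
  obtain ⟨C, c1, c2, c3, -⟩ := exists_clique_minor G r _
    (univ.map ⟨fun v : V => ({v} : Finset V), singleton_injective⟩) rfl (by simp)
    (by simpa using fun v w (h : ¬ v = w) => Ne.symm h)
    (by
      intro X hX
      obtain ⟨v, -, rfl⟩ := mem_map.1 hX
      change (G.induce (({v} : Finset V) : Set V)).Connected
      rw [Finset.coe_singleton]
      exact (SimpleGraph.connected_iff _).2
        ⟨SimpleGraph.Preconnected.of_subsingleton, ⟨⟨v, rfl⟩⟩⟩) (by
      rw [hcard, orderedPairs, sum_map]
      refine h.trans ?_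
      rw [← SimpleGraph.sum_degrees_eq_twice_card_edges]
      refine sum_le_sum fun v _ => ?_
      rw [filter_map, card_map, ← SimpleGraph.card_neighborFinset_eq_degree]
      refine card_le_card fun w hw => ?_
      rw [SimpleGraph.mem_neighborFinset] at hw
      simp [Touch, hw, hw.ne])
  exact ⟨C, c1, c2, c3⟩

end Mader

section Planar

variable {V : Type} {G : SimpleGraph V}

namespace Drawing

lemma mem_img {Γ : Drawing G} {u v : V} {p : ℝ × ℝ} :
    p ∈ Γ.img s(u, v) ↔ ∃ t ∈ Icc (0 : ℝ) 1, Γ.arc u v t = p := Iff.rfl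

lemma joinedIn_img (Γ : Drawing G) {u v : V} (h : G.Adj u v) :
    JoinedIn (Γ.img s(u, v)) (Γ.vpos u) (Γ.vpos v) :=
  JoinedIn.ofLine (f := Γ.arc u v) (Γ.arc_cont u v h) (Γ.arc_start u v h) (Γ.arc_end u v h)
    subset_rfl

lemma vpos_mem_img {Γ : Drawing G} {u v w : V} (h : G.Adj u v) (hw : Γ.vpos w ∈ Γ.img s(u, v)) :
    w = u ∨ w = v := by
  obtain ⟨t, ht, hp⟩ := mem_img.1 hw
  rcases ht.1.eq_or_lt with rfl | h0
  · rw [Γ.arc_start u v h] at hp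
    exact Or.inl (Γ.vpos_inj hp.symm)
  rcases ht.2.eq_or_lt with rfl | h1
  · rw [Γ.arc_end u v h] at hp
    exact Or.inr (Γ.vpos_inj hp.symm)
  · exact absurd ⟨w, hp.symm⟩ (Γ.arc_avoids u v h t ⟨h0, h1⟩)

/-- The part of the plane covered by the drawing of the subgraph of `H` induced by `X`. -/
def trace (Γ : Drawing G) (H : SimpleGraph V) (X : Set V) : Set (ℝ × ℝ) :=
  Γ.vpos '' X ∪ {p | ∃ u ∈ X, ∃ v ∈ X, H.Adj u v ∧ p ∈ Γ.img s(u, v)}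

lemma disjoint_trace (Γ : Drawing G) {H : SimpleGraph V} (hH : H ≤ G)
    (hc : ∀ e ∈ H.edgeSet, ∀ f ∈ H.edgeSet, ¬ Γ.Crosses e f) {X Y : Set V} (hXY : Disjoint X Y) :
    Disjoint (Γ.trace H X) (Γ.trace H Y) := by
  rw [Set.disjoint_left] at hXY ⊢
  rintro p (⟨x, hx, rfl⟩ | ⟨u, hu, v, hv, huv, hp⟩) (⟨y, hy, hxy⟩ | ⟨u', hu', v', hv', huv', hp'⟩)
  · exact hXY hx (Γ.vpos_inj hxy ▸ hy)
  · rcases vpos_mem_img (hH huv') hp' with rfl | rfl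
    · exact hXY hx hu'
    · exact hXY hx hv'
  · subst hxy
    rcases vpos_mem_img (hH huv) hp with rfl | rfl
    · exact hXY hu hy
    · exact hXY hv hy
  · by_cases hr : p ∈ range Γ.vpos
    · obtain ⟨w, rfl⟩ := hr
      rcases vpos_mem_img (hH huv) hp with rfl | rfl <;>
        rcases vpos_mem_img (hH huv') hp' with rfl | rfl <;> exact hXY ‹_› ‹_›
    · refine hc s(u, v) huv s(u', v') huv' ⟨p, hH huv, hH huv', fun h => ?_, hp, hp', hr⟩
      have : u ∈ s(u', v') := h ▸ Sym2.mem_mk_left u v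
      rcases Sym2.mem_iff.1 this with rfl | rfl
      · exact hXY hu hu'
      · exact hXY hu hv'

lemma joinedIn_trace (Γ : Drawing G) {H : SimpleGraph V} (hH : H ≤ G) {X : Set V} {a b : X}
    (h : (H.induce X).Reachable a b) : JoinedIn (Γ.trace H X) (Γ.vpos a) (Γ.vpos b) := by
  obtain ⟨w⟩ := h
  induction w with
  | nil => exact JoinedIn.refl (Or.inl ⟨_, Subtype.coe_prop _, rfl⟩)
  | @cons u v w h _ ih =>
    exact ((Γ.joinedIn_img (hH h)).mono fun p hp =>
      Or.inr ⟨u, u.2, v, v.2, h, hp⟩).trans ih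

/-- A crossing-free part of a drawing contains no subdivision of `K_{3,3}`. -/
lemma false_of_k33 (Γ : Drawing G) {H : SimpleGraph V} (hH : H ≤ G)
    (hc : ∀ e ∈ H.edgeSet, ∀ f ∈ H.edgeSet, ¬ Γ.Crosses e f) (a b : Fin 3 → V)
    (X : Fin 3 → Fin 3 → Set V) (ha : ∀ i j, a i ∈ X i j) (hb : ∀ i j, b j ∈ X i j)
    (hr : ∀ i j, (H.induce (X i j)).Reachable ⟨a i, ha i j⟩ ⟨b j, hb i j⟩)
    (hd : ∀ i i' j j', i ≠ i' → j ≠ j' → Disjoint (X i j) (X i' j')) : False := by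
  obtain ⟨i, i', j, j', hi, hj, p, hp, hp'⟩ :=
    k33_joinedIn_meet (a := Γ.vpos ∘ a) (b := Γ.vpos ∘ b)
      (fun i j => Γ.trace H (X i j)) fun i j => Γ.joinedIn_trace hH (hr i j)
  exact Set.disjoint_left.1 (Γ.disjoint_trace hH hc (hd i i' j j' hi hj)) hp hp'

lemma crossingSet_finite [Finite V] (Γ : Drawing G) : Γ.crossingSet.Finite := by
  have : Γ.crossingSet ⊆ ⋃ q : (V × V) × (V × V), {p | G.Adj q.1.1 q.1.2 ∧ G.Adj q.2.1 q.2.2 ∧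
      s(q.1.1, q.1.2) ≠ s(q.2.1, q.2.2) ∧ p ∈ Γ.img s(q.1.1, q.1.2) ∩ Γ.img s(q.2.1, q.2.2)} := by
    rintro p ⟨e, f, he, hf, hne, hpe, hpf, -⟩
    induction e with | _ u v
    induction f with | _ w z
    exact mem_iUnion.2 ⟨((u, v), (w, z)), he, hf, hne, hpe, hpf⟩
  refine (finite_iUnion fun q => ?_).subset this
  by_cases h : G.Adj q.1.1 q.1.2 ∧ G.Adj q.2.1 q.2.2 ∧ s(q.1.1, q.1.2) ≠ s(q.2.1, q.2.2)
  · exact (Γ.inter_finite _ _ _ _ h.1 h.2.1 h.2.2).subset fun p hp => hp.2.2.2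
  · exact finite_empty.subset fun p hp => h ⟨hp.1, hp.2.1, hp.2.2.1⟩

lemma IsKGapPlanar.crossings_le [Finite V] {Γ : Drawing G} (h : Γ.IsKGapPlanar 1) :
    Γ.crossings ≤ G.edgeSet.ncard := by
  obtain ⟨o, ho, ho'⟩ := h
  refine ncard_le_ncard_of_injOn o (fun p hp => ?_) (fun p hp q hq hpq => ?_) (toFinite _)
  · obtain ⟨f, hf⟩ := ho p hp
    exact hf.1
  · exact ncard_le_one (Γ.crossingSet_finite.subset fun _ h => h.1) |>.1 (ho' (o q)) p ⟨hp, hpq⟩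
      q ⟨hq, rfl⟩

end Drawing

lemma false_of_clique_minor [Fintype V] (Γ : Drawing G) {H : SimpleGraph V} (hH : H ≤ G)
    (hc : ∀ e ∈ H.edgeSet, ∀ f ∈ H.edgeSet, ¬ Γ.Crosses e f) (C : Fin 6 → Finset V)
    (c1 : ∀ i j, i ≠ j → Disjoint (C i) (C j))
    (c2 : ∀ i, (H.induce (C i : Set V)).Connected)
    (c3 : ∀ i j, i ≠ j → ∃ x ∈ C i, ∃ y ∈ C j, H.Adj x y) : False := by
  have hne : ∀ i, ∃ v, v ∈ C i := fun i => by
    obtain ⟨⟨v, hv⟩⟩ := (c2 i).nonempty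
    exact ⟨v, hv⟩
  choose v hv using hne
  let l : Fin 3 → Fin 6 := Fin.castLE (by omega)
  let r : Fin 3 → Fin 6 := Fin.natAdd 3
  have hlr : ∀ i j, l i ≠ r j := by decide
  have hl : ∀ i i', i ≠ i' → l i ≠ l i' := by decide
  have hr : ∀ i i', i ≠ i' → r i ≠ r i' := by decide
  refine Γ.false_of_k33 hH hc (fun i => v (l i)) (fun j => v (r j))
    (fun i j => (C (l i) : Set V) ∪ C (r j)) (fun i j => Or.inl (hv _)) (fun i j => Or.inr (hv _))
    (fun i j => ?_) (fun i i' j j' hi hj => ?_)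
  · obtain ⟨x, hx, y, hy, hxy⟩ := c3 _ _ (hlr i j)
    exact (SimpleGraph.connected_induce_union (c2 _).preconnected (c2 _).preconnected hx hy
      hxy).preconnected _ _
  · simp only [Set.disjoint_union_left, Set.disjoint_union_right, Finset.disjoint_coe]
    exact ⟨⟨c1 _ _ (hl _ _ hi), c1 _ _ (hlr _ _).symm⟩, c1 _ _ (hlr _ _), c1 _ _ (hr _ _ hj)⟩

/-- A graph with a drawing with few crossings has few edges. -/
lemma ncard_edgeSet_le [Fintype V] [Nonempty V] (Γ : Drawing G) :
    G.edgeSet.ncard ≤ 16 * Fintype.card V + Γ.crossings := by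
  classical
  by_contra! hlt
  obtain ⟨v₀⟩ := ‹Nonempty V›
  have : Nonempty (Sym2 V) := ⟨s(v₀, v₀)⟩
  have : Nonempty V := ⟨v₀⟩
  choose! e f hef using fun (p : ℝ × ℝ) (hp : p ∈ Γ.crossingSet) => hp
  have hH : G.deleteEdges (e '' Γ.crossingSet) ≤ G := SimpleGraph.deleteEdges_le _
  have hcard : G.edgeSet.ncard ≤ (G.deleteEdges (e '' Γ.crossingSet)).edgeSet.ncard +
      Γ.crossings := by
    rw [SimpleGraph.edgeSet_deleteEdges]
    exact (ncard_le_ncard_sdiff_add_ncard _ _ (Γ.crossingSet_finite.image e)).trans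
      (Nat.add_le_add_left (ncard_image_le Γ.crossingSet_finite) _)
  obtain ⟨C, c1, c2, c3⟩ := exists_clique_minor_of_card_edges
    (G.deleteEdges (e '' Γ.crossingSet)) 5 (by
      rw [← Set.ncard_coe_finset, SimpleGraph.coe_edgeFinset]
      omega)
  refine false_of_clique_minor Γ hH (fun a ha b hb => ?_) C c1 c2 c3
  rw [SimpleGraph.edgeSet_deleteEdges] at ha hb
  rintro ⟨p, hp⟩
  have hpc : p ∈ Γ.crossingSet := ⟨a, b, hp⟩
  have hep := hef p hpc
  have h1 : e p ≠ a := fun h => ha.2 ⟨p, hpc, h⟩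
  have h2 : e p ≠ b := fun h => hb.2 ⟨p, hpc, h⟩
  obtain ⟨he, -, -, hpe, -, hr⟩ := hep
  obtain ⟨ha', hb', hab, hpa, hpb, -⟩ := hp
  generalize e p = g at *
  induction a with | _ a₁ a₂
  induction b with | _ b₁ b₂
  induction g with | _ g₁ g₂
  exact Γ.no_triple_point p hr g₁ g₂ a₁ a₂ b₁ b₂ he ha' hb' h1 h2 hab ⟨hpe, hpa, hpb⟩

lemma exists_crossings_eq_crNum (h : Nonempty (Drawing G)) :
    ∃ Γ : Drawing G, Γ.crossings = crNum G := by
  obtain ⟨Γ⟩ := h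
  exact Nat.sInf_mem (s := {n | ∃ Γ : Drawing G, Γ.crossings = n}) ⟨_, Γ, rfl⟩

lemma crNum_le (Γ : Drawing G) : crNum G ≤ Γ.crossings := Nat.sInf_le ⟨Γ, rfl⟩

lemma crNumRestricted_le {P : Drawing G → Prop} {Γ : Drawing G} (h : P Γ) :
    crNumRestricted G P ≤ Γ.crossings := Nat.sInf_le ⟨Γ, h, rfl⟩

lemma exists_crossings_eq_crNumRestricted {P : Drawing G → Prop} (h : ∃ Γ, P Γ) :
    ∃ Γ : Drawing G, P Γ ∧ Γ.crossings = crNumRestricted G P := by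
  obtain ⟨Γ, hΓ⟩ := h
  exact Nat.sInf_mem (s := {n | ∃ Γ : Drawing G, P Γ ∧ Γ.crossings = n}) ⟨_, Γ, hΓ, rfl⟩

/-- The 1-gap-planar crossing ratio is at most linear. -/
theorem crNumRestricted_oneGap_le (n : ℕ) (G : SimpleGraph (Fin n))
    (h : ∃ Γ : Drawing G, Γ.IsKGapPlanar 1) (h1 : 1 ≤ crNum G) :
    crNumRestricted G (fun Γ => Γ.IsKGapPlanar 1) ≤ 17 * n * crNum G := by
  obtain ⟨Γ, hΓ⟩ := h
  obtain ⟨Γ', hΓ'⟩ := exists_crossings_eq_crNum ⟨Γ⟩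
  have h2 := (crNumRestricted_le (P := fun Γ => Γ.IsKGapPlanar 1) hΓ).trans hΓ.crossings_le
  rcases Nat.eq_zero_or_pos n with rfl | hn
  · have : G.edgeSet = ∅ := eq_empty_of_isEmpty _
    rw [this] at h2
    simpa using h2
  · have : Nonempty (Fin n) := ⟨⟨0, hn⟩⟩
    have h3 := ncard_edgeSet_le Γ'
    rw [Fintype.card_fin, hΓ'] at h3
    nlinarith

end Planar

section Straight

variable {V : Type} {G : SimpleGraph V}

/-- The straight-line drawing with given vertex positions. -/
def straightDrawing (G : SimpleGraph V) (p : V → ℝ × ℝ) (inj : Function.Injective p)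
    (avoid : ∀ u v w, G.Adj u v → p w ∈ segment ℝ (p u) (p v) → w = u ∨ w = v)
    (meet : ∀ u v w z, G.Adj u v → G.Adj w z → s(u, v) ≠ s(w, z) →
      (segment ℝ (p u) (p v) ∩ segment ℝ (p w) (p z)).Finite)
    (triple : ∀ x, x ∉ range p → ∀ u₁ v₁ u₂ v₂ u₃ v₃, G.Adj u₁ v₁ → G.Adj u₂ v₂ → G.Adj u₃ v₃ →
      s(u₁, v₁) ≠ s(u₂, v₂) → s(u₁, v₁) ≠ s(u₃, v₃) → s(u₂, v₂) ≠ s(u₃, v₃) →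
      ¬ (x ∈ segment ℝ (p u₁) (p v₁) ∧ x ∈ segment ℝ (p u₂) (p v₂) ∧
        x ∈ segment ℝ (p u₃) (p v₃))) : Drawing G where
  vpos := p
  vpos_inj := inj
  arc u v t := AffineMap.lineMap (p u) (p v) t
  arc_symm u v t := (AffineMap.lineMap_apply_one_sub _ _ _).symm
  arc_cont _ _ _ := AffineMap.lineMap_continuous.continuousOn
  arc_injOn u v h := (AffineMap.lineMap_injective ℝ (inj.ne h.ne)).injOn
  arc_start _ _ _ := AffineMap.lineMap_apply_zero _ _
  arc_end _ _ _ := AffineMap.lineMap_apply_one _ _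
  arc_avoids u v h t ht := by
    rintro ⟨w, hw⟩
    rcases avoid u v w h (by
      rw [hw, segment_eq_image_lineMap]
      exact mem_image_of_mem _ (Ioo_subset_Icc_self ht)) with rfl | rfl
    · have := AffineMap.lineMap_injective ℝ (inj.ne h.ne)
        (hw.symm.trans (AffineMap.lineMap_apply_zero _ _).symm)
      exact ht.1.ne' this
    · have := AffineMap.lineMap_injective ℝ (inj.ne h.ne)
        (hw.symm.trans (AffineMap.lineMap_apply_one _ _).symm)
      exact ht.2.ne this
  inter_finite u v w z h h' hne := by
    have := meet u v w z h h' hne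
    rwa [segment_eq_image_lineMap, segment_eq_image_lineMap] at this
  no_triple_point x hx u₁ v₁ u₂ v₂ u₃ v₃ h₁ h₂ h₃ h₁₂ h₁₃ h₂₃ := by
    have := triple x hx u₁ v₁ u₂ v₂ u₃ v₃ h₁ h₂ h₃ h₁₂ h₁₃ h₂₃
    rwa [segment_eq_image_lineMap, segment_eq_image_lineMap, segment_eq_image_lineMap] at this

namespace Drawing

variable {V' : Type} {G' : SimpleGraph V'}

/-- The drawing of a subgraph induced by a drawing. -/
def comap (Γ : Drawing G) (f : V' ↪ V) (hf : ∀ u v, G'.Adj u v → G.Adj (f u) (f v)) :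
    Drawing G' where
  vpos := Γ.vpos ∘ f
  vpos_inj := Γ.vpos_inj.comp f.injective
  arc u v := Γ.arc (f u) (f v)
  arc_symm u v := Γ.arc_symm _ _
  arc_cont u v h := Γ.arc_cont _ _ (hf u v h)
  arc_injOn u v h := Γ.arc_injOn _ _ (hf u v h)
  arc_start u v h := Γ.arc_start _ _ (hf u v h)
  arc_end u v h := Γ.arc_end _ _ (hf u v h)
  arc_avoids u v h t ht hr := Γ.arc_avoids _ _ (hf u v h) t ht (range_comp_subset_range _ _ hr)
  inter_finite u v w z h h' hne := Γ.inter_finite _ _ _ _ (hf u v h) (hf w z h') fun e =>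
    hne (Sym2.map.injective f.injective e)
  no_triple_point x hx u₁ v₁ u₂ v₂ u₃ v₃ h₁ h₂ h₃ h₁₂ h₁₃ h₂₃ := by
    have inj := Sym2.map.injective f.injective
    rintro ⟨x₁, x₂, x₃⟩
    refine Γ.no_triple_point x ?_ _ _ _ _ _ _ (hf _ _ h₁) (hf _ _ h₂) (hf _ _ h₃)
      (fun e => h₁₂ (inj e)) (fun e => h₁₃ (inj e)) (fun e => h₂₃ (inj e)) ⟨x₁, x₂, x₃⟩
    rintro ⟨w, rfl⟩
    rcases vpos_mem_img (hf _ _ h₁) x₁ with rfl | rfl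
    · exact hx ⟨u₁, rfl⟩
    · exact hx ⟨v₁, rfl⟩

lemma img_comap (Γ : Drawing G) (f : V' ↪ V) (hf : ∀ u v, G'.Adj u v → G.Adj (f u) (f v))
    (e : Sym2 V') : (Γ.comap f hf).img e = Γ.img (e.map f) := by
  induction e with | _ u v
  rfl

lemma Crossing.of_comap {Γ : Drawing G} {f : V' ↪ V} {hf : ∀ u v, G'.Adj u v → G.Adj (f u) (f v)}
    {e e' : Sym2 V'} {p : ℝ × ℝ} (h : (Γ.comap f hf).Crossing e e' p) :
    Γ.Crossing (e.map f) (e'.map f) p := by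
  obtain ⟨he, he', hne, hp, hp', hr⟩ := h
  rw [img_comap] at hp hp'
  induction e with | _ u v
  induction e' with | _ u' v'
  refine ⟨hf _ _ he, hf _ _ he', fun h => hne (Sym2.map.injective f.injective h), hp, hp', ?_⟩
  rintro ⟨w, rfl⟩
  rcases vpos_mem_img (hf _ _ he) hp with rfl | rfl
  · exact hr ⟨u, rfl⟩
  · exact hr ⟨v, rfl⟩

lemma crossingSet_comap_subset (Γ : Drawing G) (f : V' ↪ V)
    (hf : ∀ u v, G'.Adj u v → G.Adj (f u) (f v)) :
    (Γ.comap f hf).crossingSet ⊆ Γ.crossingSet := fun _ ⟨e, e', h⟩ =>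
  ⟨e.map f, e'.map f, h.of_comap⟩

lemma crossings_comap_le [Finite V] (Γ : Drawing G) (f : V' ↪ V)
    (hf : ∀ u v, G'.Adj u v → G.Adj (f u) (f v)) : (Γ.comap f hf).crossings ≤ Γ.crossings :=
  ncard_le_ncard (Γ.crossingSet_comap_subset f hf) Γ.crossingSet_finite

/-- At most two edges pass through a crossing. -/
lemma Crossing.eq_or_eq {Γ : Drawing G} {e f g h : Sym2 V} {p : ℝ × ℝ} (hp : Γ.Crossing e f p)
    (hp' : Γ.Crossing g h p) : g = e ∨ g = f := by
  obtain ⟨he, hf, hef, hpe, hpf, hr⟩ := hp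
  obtain ⟨hg, -, -, hpg, -, -⟩ := hp'
  by_contra! hne
  induction e with | _ e₁ e₂
  induction f with | _ f₁ f₂
  induction g with | _ g₁ g₂
  exact Γ.no_triple_point p hr _ _ _ _ _ _ he hf hg hef hne.1.symm hne.2.symm ⟨hpe, hpf, hpg⟩

lemma IsKGapPlanar.comap [Finite V] [Nonempty V'] {Γ : Drawing G} (h : Γ.IsKGapPlanar 1) (f : V' ↪ V)
    (hf : ∀ u v, G'.Adj u v → G.Adj (f u) (f v)) : (Γ.comap f hf).IsKGapPlanar 1 := by
  obtain ⟨o, ho, ho'⟩ := h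
  have key : ∀ p ∈ (Γ.comap f hf).crossingSet, ∃ e : Sym2 V',
      (∃ e', (Γ.comap f hf).Crossing e e' p) ∧ e.map f = o p := by
    rintro p ⟨e, e', h⟩
    obtain ⟨g, hg⟩ := ho p ⟨_, _, h.of_comap⟩
    rcases h.of_comap.eq_or_eq hg with h' | h'
    · exact ⟨e, ⟨e', h⟩, h'.symm⟩
    · obtain ⟨a, b, c, d, i, j⟩ := h
      exact ⟨e', ⟨e, b, a, c.symm, i, d, j⟩, h'.symm⟩
  obtain ⟨v₀⟩ := ‹Nonempty V'›
  have : Nonempty (Sym2 V') := ⟨s(v₀, v₀)⟩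
  choose! o' h' using key
  refine ⟨o', fun p hp => (h' p hp).1, fun e => ?_⟩
  refine (ncard_le_ncard ?_ (Γ.crossingSet_finite.subset fun p hp => hp.1)).trans (ho' (e.map f))
  rintro p ⟨hp, rfl⟩
  exact ⟨Γ.crossingSet_comap_subset f hf hp, (h' p hp).2.symm⟩

end Drawing

end Straight

section BundleGraph

/-- First ends of the twelve bundled and the four unbundled edges of the base graph. -/
def bundleSrc : Fin 16 → Fin 11 := ![0, 1, 2, 3, 4, 5, 6, 7, 8, 9, 0, 5, 1, 2, 3, 4]

/-- Second ends of the twelve bundled and the four unbundled edges of the base graph. -/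
def bundleTgt : Fin 16 → Fin 11 := ![1, 2, 3, 4, 5, 6, 7, 8, 9, 0, 10, 10, 6, 7, 8, 9]

/-- Base vertices, and middle vertices of the paths of length two in the bundles. -/
abbrev BundleVertex (m : ℕ) : Type := Fin 11 ⊕ Fin m

/-- Base edges, and the two edges at each middle vertex. -/
abbrev BundleEdge (m : ℕ) : Type := Fin 16 ⊕ (Fin m × Bool)

variable {m : ℕ}

/-- The bundle containing a middle vertex. -/
def strandLabel (w : Fin m) : Fin 16 := ⟨w % 12, by omega⟩

/-- The base edge to which an edge is parallel. -/
def edgeLabel : BundleEdge m → Fin 16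
  | Sum.inl k => k
  | Sum.inr (w, _) => strandLabel w

/-- The rank of an edge in its bundle; the base edge has rank zero. -/
def edgeRank : BundleEdge m → ℕ
  | Sum.inl _ => 0
  | Sum.inr (w, _) => w / 12 + 1

/-- The first end of an edge, which is its middle vertex if it has one. -/
def edgeFst : BundleEdge m → BundleVertex m
  | Sum.inl k => Sum.inl (bundleSrc k)
  | Sum.inr (w, _) => Sum.inr w

/-- The second end of an edge. -/
def edgeSnd : BundleEdge m → BundleVertex m
  | Sum.inl k => Sum.inl (bundleTgt k)
  | Sum.inr (w, false) => Sum.inl (bundleSrc (strandLabel w))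
  | Sum.inr (w, true) => Sum.inl (bundleTgt (strandLabel w))

/-- An edge as an unordered pair of vertices. -/
def edgeSym (e : BundleEdge m) : Sym2 (BundleVertex m) := s(edgeFst e, edgeSnd e)

/-- A decagon with four long diagonals and a path of length two between two opposite corners,
where the edges of the decagon and of the path are thickened to bundles of `m` paths of length
two in total. -/
def bundleGraph (m : ℕ) : SimpleGraph (BundleVertex m) := SimpleGraph.fromEdgeSet (range edgeSym)

lemma bundleSrc_ne_bundleTgt : ∀ k, bundleSrc k ≠ bundleTgt k := by decide

lemma edgeFst_ne_edgeSnd : ∀ e : BundleEdge m, edgeFst e ≠ edgeSnd e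
  | Sum.inl k => fun h => bundleSrc_ne_bundleTgt k (Sum.inl_injective h)
  | Sum.inr (_, false) => Sum.inr_ne_inl
  | Sum.inr (_, true) => Sum.inr_ne_inl

lemma edgeSym_injective : Function.Injective (edgeSym (m := m)) := by
  have hb : ∀ k l, (bundleSrc k = bundleSrc l ∧ bundleTgt k = bundleTgt l ∨
      bundleSrc k = bundleTgt l ∧ bundleTgt k = bundleSrc l) → k = l := by decide
  have hst := bundleSrc_ne_bundleTgt
  rintro (k | ⟨w, _ | _⟩) (l | ⟨w', _ | _⟩) h <;>
    simp only [edgeSym, edgeFst, edgeSnd, Sym2.eq_iff, Sum.inl.injEq, Sum.inr.injEq, reduceCtorEq,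
      false_and, and_false, or_false] at h
  · rw [hb k l h]
  · rw [h.1]
  · obtain ⟨rfl, h⟩ := h
    exact absurd h (hst _)
  · obtain ⟨rfl, h⟩ := h
    exact absurd h.symm (hst _)
  · rw [h.1]

lemma bundleGraph_adj {u v : BundleVertex m} :
    (bundleGraph m).Adj u v ↔ ∃ e, edgeSym e = s(u, v) := by
  rw [bundleGraph, SimpleGraph.fromEdgeSet_adj, mem_range, and_iff_left_of_imp]
  rintro ⟨e, he⟩ rfl
  rcases Sym2.eq_iff.1 he with h | h <;> exact edgeFst_ne_edgeSnd e (h.1.trans h.2.symm)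

lemma edgeSet_bundleGraph : (bundleGraph m).edgeSet = range edgeSym := by
  ext e
  induction e with | _ u v
  exact bundleGraph_adj

end BundleGraph

section LowerBound

variable {m : ℕ}

/-- The spanning subgraph formed by two of the unbundled edges and a set of other edges. -/
def selectedGraph (m : ℕ) (Z : Set (BundleEdge m)) : SimpleGraph (BundleVertex m) :=
  SimpleGraph.fromEdgeSet (edgeSym '' Z)

lemma selectedGraph_adj {Z : Set (BundleEdge m)} {u v : BundleVertex m} :
    (selectedGraph m Z).Adj u v ↔ ∃ e ∈ Z, edgeSym e = s(u, v) := by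
  rw [selectedGraph, SimpleGraph.fromEdgeSet_adj, mem_image, and_iff_left_of_imp]
  rintro ⟨e, -, he⟩ rfl
  rcases Sym2.eq_iff.1 he with h | h <;> exact edgeFst_ne_edgeSnd e (h.1.trans h.2.symm)

lemma selectedGraph_le {Z : Set (BundleEdge m)} : selectedGraph m Z ≤ bundleGraph m :=
  fun u v h => by
    obtain ⟨e, -, he⟩ := selectedGraph_adj.1 h
    exact bundleGraph_adj.2 ⟨e, he⟩

/-- The vertices in the part of the graph spanned by a set of base vertices. -/
def bundleSpan (m : ℕ) (S : Set (Fin 11)) : Set (BundleVertex m) :=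
  {v | Sum.elim (fun a => a ∈ S)
    (fun w => bundleSrc (strandLabel w) ∈ S ∧ bundleTgt (strandLabel w) ∈ S) v}

lemma disjoint_bundleSpan {S T : Set (Fin 11)} (h : Disjoint S T) :
    Disjoint (bundleSpan m S) (bundleSpan m T) := by
  rw [Set.disjoint_left] at h ⊢
  rintro (a | w) h₁ h₂
  · exact h h₁ h₂
  · exact h h₁.1 h₂.1

/-- Adjacency in the base graph without two of the four long diagonals. -/
def BaseAdj (i j : Fin 4) (a b : Fin 11) : Prop :=
  ∃ k : Fin 16, (k < 12 ∨ k = Fin.natAdd 12 i ∨ k = Fin.natAdd 12 j) ∧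
    (bundleSrc k = a ∧ bundleTgt k = b ∨ bundleSrc k = b ∧ bundleTgt k = a)

instance (i j : Fin 4) (a b : Fin 11) : Decidable (BaseAdj i j a b) := by
  unfold BaseAdj; infer_instance

/-- The edges of a fixed rank together with two of the four long diagonals. -/
def rankEdges (m t : ℕ) (i j : Fin 4) : Set (BundleEdge m) :=
  {e | edgeLabel e < 12 ∧ edgeRank e = t ∨
    e = Sum.inl (Fin.natAdd 12 i) ∨ e = Sum.inl (Fin.natAdd 12 j)}

lemma reachable_of_baseAdj {t : ℕ} (ht : 12 * t ≤ m) {i j : Fin 4} {S : Set (Fin 11)}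
    {a b : Fin 11} (hab : BaseAdj i j a b) (ha : a ∈ S) (hb : b ∈ S) :
    ((selectedGraph m (rankEdges m t i j)).induce (bundleSpan m S)).Reachable
      ⟨Sum.inl a, ha⟩ ⟨Sum.inl b, hb⟩ := by
  obtain ⟨k, hk, hkab⟩ := hab
  wlog h : bundleSrc k = a ∧ bundleTgt k = b generalizing a b
  · exact (this hb ha hkab.symm (hkab.resolve_left h)).symm
  obtain ⟨rfl, rfl⟩ := h
  by_cases hd : k < 12 ∧ t ≠ 0
  · obtain ⟨hk, ht0⟩ := hd
    have hk' : (k : ℕ) < 12 := hk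
    let w : Fin m := ⟨12 * (t - 1) + k, by omega⟩
    have hw : strandLabel w = k := Fin.ext (by simp only [strandLabel, w]; omega)
    have hr : (w : ℕ) / 12 + 1 = t := by simp only [w]; omega
    have hwS : (Sum.inr w : BundleVertex m) ∈ bundleSpan m S := by
      change _ ∈ S ∧ _ ∈ S
      rw [hw]
      exact ⟨ha, hb⟩
    have h1 : ((selectedGraph m (rankEdges m t i j)).induce (bundleSpan m S)).Adj
        ⟨Sum.inr w, hwS⟩ ⟨Sum.inl (bundleSrc k), ha⟩ := by
      refine selectedGraph_adj.2 ⟨Sum.inr (w, false), Or.inl ⟨?_, hr⟩, ?_⟩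
      · simpa only [edgeLabel, hw] using hk
      · simp only [edgeSym, edgeFst, edgeSnd, hw]
        rfl
    have h2 : ((selectedGraph m (rankEdges m t i j)).induce (bundleSpan m S)).Adj
        ⟨Sum.inr w, hwS⟩ ⟨Sum.inl (bundleTgt k), hb⟩ := by
      refine selectedGraph_adj.2 ⟨Sum.inr (w, true), Or.inl ⟨?_, hr⟩, ?_⟩
      · simpa only [edgeLabel, hw] using hk
      · simp only [edgeSym, edgeFst, edgeSnd, hw]
        rfl
    exact h1.symm.reachable.trans h2.reachable
  · refine SimpleGraph.Adj.reachable (selectedGraph_adj.2 ⟨Sum.inl k, ?_, rfl⟩)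
    rcases hk with hk | rfl | rfl
    · exact Or.inl ⟨hk, (not_not.1 fun h => hd ⟨hk, fun h' => h h'.symm⟩)⟩
    · exact Or.inr (Or.inl rfl)
    · exact Or.inr (Or.inr rfl)

lemma reachable_of_isChain {t : ℕ} (ht : 12 * t ≤ m) {i j : Fin 4} {S : Set (Fin 11)} :
    ∀ {l : List (Fin 11)} {a b : Fin 11}, (a :: l).IsChain (BaseAdj i j) →
      (a :: l).getLast? = some b → (∀ x ∈ a :: l, x ∈ S) → ∀ (ha : a ∈ S) (hb : b ∈ S),
    ((selectedGraph m (rankEdges m t i j)).induce (bundleSpan m S)).Reachable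
      ⟨Sum.inl a, ha⟩ ⟨Sum.inl b, hb⟩
  | [], a, b, _, hl, _, ha, hb => by
    obtain rfl : a = b := by simpa using hl
    exact SimpleGraph.Reachable.refl _
  | c :: l, a, b, hc, hl, hS, ha, hb => by
    rw [List.isChain_cons_cons] at hc
    have hcS : c ∈ S := hS c (by simp)
    exact (reachable_of_baseAdj ht hc.1 ha hcS).trans
      (reachable_of_isChain ht hc.2 (by simpa using hl) (fun x hx => hS x (by simp_all)) hcS hb)

/-- A list of consecutive corners of the decagon. -/
def decagonPath (a b : ℕ) : List (Fin 11) :=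
  (List.range' a (b + 1 - a)).map fun x => Fin.ofNat 11 (x % 10)

/-- The first colour class of a subdivision of `K_{3,3}` that uses two long diagonals. -/
def crossedLeft (i j : Fin 4) : Fin 3 → Fin 11 :=
  ![bundleSrc (Fin.natAdd 12 i), 5, bundleTgt (Fin.natAdd 12 j)]

/-- The second colour class of a subdivision of `K_{3,3}` that uses two long diagonals. -/
def crossedRight (i j : Fin 4) : Fin 3 → Fin 11 :=
  ![bundleSrc (Fin.natAdd 12 j), bundleTgt (Fin.natAdd 12 i), 0]

/-- The paths of a subdivision of `K_{3,3}` that uses two long diagonals. -/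
def crossedPath (i j : Fin 4) : Fin 3 → Fin 3 → List (Fin 11) :=
  ![![decagonPath (i + 1) (j + 1), [bundleSrc (Fin.natAdd 12 i), bundleTgt (Fin.natAdd 12 i)],
      (decagonPath 0 (i + 1)).reverse],
    ![(decagonPath (j + 1) 5).reverse, decagonPath 5 (i + 6), [5, 10, 0]],
    ![[bundleTgt (Fin.natAdd 12 j), bundleSrc (Fin.natAdd 12 j)],
      (decagonPath (i + 6) (j + 6)).reverse, decagonPath (j + 6) 10]]

lemma crossedPath_spec : ∀ i j : Fin 4, i < j → ∀ a b : Fin 3,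
    (crossedPath i j a b).IsChain (BaseAdj i j) ∧
    (crossedPath i j a b).head? = some (crossedLeft i j a) ∧
    (crossedPath i j a b).getLast? = some (crossedRight i j b) := by
  decide +kernel

lemma crossedPath_disjoint : ∀ i j : Fin 4, i < j → ∀ a a' b b' : Fin 3, a ≠ a' → b ≠ b' →
    ∀ x ∈ crossedPath i j a b, x ∉ crossedPath i j a' b' := by
  decide +kernel

lemma crosses_of_not_crosses {t : ℕ} (ht : 12 * t ≤ m) {i j : Fin 4} (hij : i < j)
    (Γ : Drawing (bundleGraph m))
    (hΓ : ∀ e f, edgeLabel e < 12 → edgeRank e = t →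
      (12 ≤ edgeLabel f ∨ edgeLabel f < 12 ∧ edgeRank f = t) →
      ¬ Γ.Crosses (edgeSym e) (edgeSym f)) :
    Γ.Crosses (edgeSym (Sum.inl (Fin.natAdd 12 i))) (edgeSym (Sum.inl (Fin.natAdd 12 j))) := by
  by_contra hcr
  have hsymm : ∀ {e f}, Γ.Crosses e f → Γ.Crosses f e := by
    rintro e f ⟨p, a, b, c, d, g, h⟩
    exact ⟨p, b, a, c.symm, g, d, h⟩
  have hirr : ∀ {e}, ¬ Γ.Crosses e e := fun ⟨p, h⟩ => h.2.2.1 rfl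
  have hlab : ∀ i : Fin 4, 12 ≤ edgeLabel (m := m) (Sum.inl (Fin.natAdd 12 i)) := by
    intro i
    change (12 : Fin 16) ≤ Fin.natAdd 12 i
    revert i
    decide
  refine Γ.false_of_k33 (selectedGraph_le (Z := rankEdges m t i j)) ?_
    (fun a => Sum.inl (crossedLeft i j a)) (fun b => Sum.inl (crossedRight i j b))
    (fun a b => bundleSpan m {x | x ∈ crossedPath i j a b})
    (fun a b => List.mem_of_mem_head? (crossedPath_spec i j hij a b).2.1)
    (fun a b => List.mem_of_mem_getLast? (crossedPath_spec i j hij a b).2.2)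
    (fun a b => ?_) fun a a' b b' ha hb => disjoint_bundleSpan (Set.disjoint_left.2
      (crossedPath_disjoint i j hij a a' b b' ha hb))
  · intro e he f hf hef
    rw [selectedGraph, SimpleGraph.edgeSet_fromEdgeSet] at he hf
    obtain ⟨⟨e, he, rfl⟩, -⟩ := he
    obtain ⟨⟨f, hf, rfl⟩, -⟩ := hf
    rcases he with he | rfl | rfl <;> rcases hf with hf | rfl | rfl
    · exact hΓ e f he.1 he.2 (Or.inr hf) hef
    · exact hΓ e _ he.1 he.2 (Or.inl (hlab _)) hef
    · exact hΓ e _ he.1 he.2 (Or.inl (hlab _)) hef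
    · exact hΓ f _ hf.1 hf.2 (Or.inl (hlab _)) (hsymm hef)
    · exact hirr hef
    · exact hcr hef
    · exact hΓ f _ hf.1 hf.2 (Or.inl (hlab _)) (hsymm hef)
    · exact hcr (hsymm hef)
    · exact hirr hef
  · obtain ⟨h1, h2, h3⟩ := crossedPath_spec i j hij a b
    generalize crossedPath i j a b = l at *
    cases l with
    | nil => simp at h2
    | cons c l =>
      obtain rfl : c = crossedLeft i j a := by simpa using h2
      exact reachable_of_isChain ht h1 h3 (fun x hx => hx) _ _

lemma exists_rank_not_crosses {ℓ : ℕ} (Γ : Drawing (bundleGraph m)) (hΓ : Γ.crossings < ℓ) :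
    ∃ t < ℓ, ∀ e f, edgeLabel e < 12 → edgeRank e = t →
      (12 ≤ edgeLabel f ∨ edgeLabel f < 12 ∧ edgeRank f = t) →
      ¬ Γ.Crosses (edgeSym e) (edgeSym f) := by
  have hr : ∀ p : ℝ × ℝ, ∃ e : BundleEdge m,
      (∃ f : BundleEdge m, edgeLabel f < 12 ∧ p ∈ Γ.img (edgeSym f)) →
        edgeLabel e < 12 ∧ p ∈ Γ.img (edgeSym e) := by
    intro p
    by_cases h : ∃ f : BundleEdge m, edgeLabel f < 12 ∧ p ∈ Γ.img (edgeSym f)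
    · obtain ⟨f, hf⟩ := h
      exact ⟨f, fun _ => hf⟩
    · exact ⟨Sum.inl 0, fun h' => absurd h' h⟩
  choose r hr using hr
  obtain ⟨t, htℓ, ht⟩ : ∃ t ∈ (Finset.range ℓ : Set ℕ),
      t ∉ (fun p => edgeRank (r p)) '' Γ.crossingSet := by
    refine exists_mem_notMem_of_ncard_lt_ncard ?_ (Γ.crossingSet_finite.image _)
    rw [ncard_coe_finset, Finset.card_range]
    exact (ncard_image_le Γ.crossingSet_finite).trans_lt hΓ
  refine ⟨t, by simpa using htℓ, ?_⟩
  rintro e f he het hf ⟨p, hp⟩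
  obtain ⟨h1, h2⟩ := hr p ⟨e, he, hp.2.2.2.1⟩
  have hpc : p ∈ Γ.crossingSet := ⟨_, _, hp⟩
  have hne : edgeRank (r p) ≠ t := fun h => ht ⟨p, hpc, h⟩
  have hre : r p ≠ e := fun h => hne (h ▸ het)
  have hrf : r p ≠ f := by
    rintro rfl
    rcases hf with hf | hf
    · exact absurd h1 (not_lt.2 hf)
    · exact hne hf.2
  have hrc : Γ.Crossing (edgeSym (r p)) (edgeSym e) p :=
    ⟨edgeSet_bundleGraph ▸ mem_range_self _, hp.1, edgeSym_injective.ne hre, h2, hp.2.2.2.1,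
      hp.2.2.2.2.2⟩
  rcases hp.eq_or_eq hrc with h | h
  · exact hre (edgeSym_injective h)
  · exact hrf (edgeSym_injective h)

/-- A 1-gap-planar drawing of the bundle graph has many crossings. -/
theorem le_crossings_bundleGraph {ℓ : ℕ} (hm : 12 * (ℓ - 1) ≤ m) (Γ : Drawing (bundleGraph m))
    (hΓ : Γ.IsKGapPlanar 1) : ℓ ≤ Γ.crossings := by
  by_contra! hlt
  obtain ⟨t, htℓ, ht⟩ := exists_rank_not_crosses Γ hlt
  have hcr : ∀ q : Fin 4 × Fin 4, q.1 < q.2 →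
      Γ.Crosses (edgeSym (Sum.inl (Fin.natAdd 12 q.1))) (edgeSym (Sum.inl (Fin.natAdd 12 q.2))) :=
    fun q hq => crosses_of_not_crosses ((Nat.mul_le_mul_left 12 (by omega)).trans hm) hq Γ ht
  choose! p hp using hcr
  obtain ⟨o, ho, ho'⟩ := hΓ
  have hinj : ∀ i j : Fin 4, edgeSym (m := m) (Sum.inl (Fin.natAdd 12 i)) =
      edgeSym (Sum.inl (Fin.natAdd 12 j)) → i = j := fun i j h => by
    have := congrArg Fin.val (Sum.inl_injective (edgeSym_injective h))
    simp only [Fin.val_natAdd] at this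
    omega
  have hown : ∀ q : Fin 4 × Fin 4, q.1 < q.2 →
      ∃ i : Fin 4, o (p q) = edgeSym (Sum.inl (Fin.natAdd 12 i)) := by
    intro q hq
    obtain ⟨f, hf⟩ := ho (p q) ⟨_, _, hp q hq⟩
    rcases (hp q hq).eq_or_eq hf with h | h
    · exact ⟨_, h⟩
    · exact ⟨_, h⟩
  choose! d hd using hown
  obtain ⟨q, hq, q', hq', hne, hqq⟩ := Finset.exists_ne_map_eq_of_card_lt_of_maps_to
    (s := Finset.univ.filter fun q : Fin 4 × Fin 4 => q.1 < q.2) (t := Finset.univ) (f := d)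
    (by decide) (fun _ _ => Finset.mem_univ _)
  simp only [Finset.mem_filter, Finset.mem_univ, true_and] at hq hq'
  have hpp : p q = p q' := by
    refine (ncard_le_one (Γ.crossingSet_finite.subset fun _ h => h.1)).1
      (ho' (edgeSym (Sum.inl (Fin.natAdd 12 (d q))))) _ ⟨⟨_, _, hp q hq⟩, hd q hq⟩ _
      ⟨⟨_, _, hp q' hq'⟩, ?_⟩
    rw [hqq]
    exact hd q' hq'
  have h1 := hp q hq
  have h2 := hp q' hq'
  rw [← hpp] at h2
  have h3 : Γ.Crossing _ _ (p q) := ⟨h2.2.1, h2.1, h2.2.2.1.symm, h2.2.2.2.2.1, h2.2.2.2.1,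
    h2.2.2.2.2.2⟩
  refine hne (Prod.ext ?_ ?_)
  all_goals
    have h4 := (h1.eq_or_eq h2).imp (hinj _ _) (hinj _ _)
    have h5 := (h1.eq_or_eq h3).imp (hinj _ _) (hinj _ _)
    omega

end LowerBound

section Orientation

/-- Twice the signed area of a triangle. -/
def orient {R : Type*} [CommRing R] (p q x : R × R) : R :=
  (q.1 - p.1) * (x.2 - p.2) - (q.2 - p.2) * (x.1 - p.1)

/-- The determinant of two vectors given as differences of points. -/
def crossProd {R : Type*} [CommRing R] (p q p' q' : R × R) : R :=
  (q.1 - p.1) * (q'.2 - p'.2) - (q.2 - p.2) * (q'.1 - p'.1)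

/-- The determinant of the equations of three lines. -/
def lineDet {R : Type*} [CommRing R] (p q p' q' p'' q'' : R × R) : R :=
  (p.1 * q.2 - p.2 * q.1) * crossProd p' q' p'' q'' +
    (p'.1 * q'.2 - p'.2 * q'.1) * crossProd p'' q'' p q +
      (p''.1 * q''.2 - p''.2 * q''.1) * crossProd p q p' q'

/-- The inclusion of the integer lattice into the plane. -/
def toPlane (p : ℤ × ℤ) : ℝ × ℝ := (p.1, p.2)

lemma orient_toPlane (p q x : ℤ × ℤ) :
    orient (toPlane p) (toPlane q) (toPlane x) = ((orient p q x : ℤ) : ℝ) := by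
  simp only [orient, toPlane]; push_cast; ring

lemma crossProd_toPlane (p q p' q' : ℤ × ℤ) :
    crossProd (toPlane p) (toPlane q) (toPlane p') (toPlane q') = ((crossProd p q p' q' : ℤ) : ℝ) := by
  simp only [crossProd, toPlane]; push_cast; ring

lemma lineDet_toPlane (p q p' q' p'' q'' : ℤ × ℤ) :
    lineDet (toPlane p) (toPlane q) (toPlane p') (toPlane q') (toPlane p'') (toPlane q'') =
      ((lineDet p q p' q' p'' q'' : ℤ) : ℝ) := by
  simp only [lineDet, crossProd, toPlane]; push_cast; ring

lemma toPlane_injective : Function.Injective toPlane := fun p q h => by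
  simp only [toPlane, Prod.mk.injEq, Int.cast_inj] at h
  exact Prod.ext h.1 h.2

lemma orient_combo {a b : ℝ} (h : a + b = 1) (p q x y : ℝ × ℝ) :
    orient p q (a • x + b • y) = a * orient p q x + b * orient p q y := by
  obtain rfl : b = 1 - a := by linarith
  simp only [orient, Prod.fst_add, Prod.snd_add, Prod.smul_fst, Prod.smul_snd, smul_eq_mul]
  ring

lemma convex_orient_nonpos (p q : ℝ × ℝ) : Convex ℝ {x | orient p q x ≤ 0} := by
  intro x hx y hy a b ha hb hab
  simp only [mem_ofPred_eq, orient_combo hab] at *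
  nlinarith

lemma convex_orient_nonneg (p q : ℝ × ℝ) : Convex ℝ {x | 0 ≤ orient p q x} := by
  intro x hx y hy a b ha hb hab
  simp only [mem_ofPred_eq, orient_combo hab] at *
  positivity

lemma convex_orient_pos (p q : ℝ × ℝ) : Convex ℝ {x | 0 < orient p q x} := by
  intro x hx y hy a b ha hb hab
  simp only [mem_ofPred_eq, orient_combo hab] at *
  rcases ha.eq_or_lt with rfl | ha'
  · obtain rfl : b = 1 := by linarith
    simpa using hy
  · positivity

lemma convex_orient_pos_or_eq {p q c : ℝ × ℝ} (hc : orient p q c = 0) :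
    Convex ℝ {x | 0 < orient p q x ∨ x = c} := by
  intro x hx y hy a b ha hb hab
  rcases ha.eq_or_lt with rfl | ha'
  · obtain rfl : b = 1 := by linarith
    simpa using hy
  rcases hb.eq_or_lt with rfl | hb'
  · obtain rfl : a = 1 := by linarith
    simpa using hx
  simp only [mem_ofPred_eq, orient_combo hab] at *
  rcases hx with hx | rfl <;> rcases hy with hy | rfl
  · left; positivity
  · left; rw [hc]; positivity
  · left; rw [hc]; positivity
  · right; rw [← add_smul, hab, one_smul]

lemma orient_eq_zero_of_mem_segment {p q x : ℝ × ℝ} (h : x ∈ segment ℝ p q) :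
    orient p q x = 0 := by
  obtain ⟨a, b, -, -, hab, rfl⟩ := h
  rw [orient_combo hab]
  simp only [orient]
  ring

lemma lineDet_eq_zero_of_mem_segment {p q p' q' p'' q'' x : ℝ × ℝ} (h : x ∈ segment ℝ p q)
    (h' : x ∈ segment ℝ p' q') (h'' : x ∈ segment ℝ p'' q'') : lineDet p q p' q' p'' q'' = 0 := by
  have h := orient_eq_zero_of_mem_segment h
  have h' := orient_eq_zero_of_mem_segment h'
  have h'' := orient_eq_zero_of_mem_segment h''
  simp only [orient, lineDet] at *
  linear_combination (norm := (simp only [crossProd]; ring)) crossProd p' q' p'' q'' * h + crossProd p'' q'' p q * h' +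
    crossProd p q p' q' * h''

lemma segment_inter_subsingleton {p q p' q' : ℝ × ℝ} (h : crossProd p q p' q' ≠ 0) :
    (segment ℝ p q ∩ segment ℝ p' q').Subsingleton := by
  have key : ∀ x, x ∈ segment ℝ p q ∩ segment ℝ p' q' →
      orient p q x = 0 ∧ orient p' q' x = 0 := fun x hx =>
    ⟨orient_eq_zero_of_mem_segment hx.1, orient_eq_zero_of_mem_segment hx.2⟩
  intro x hx y hy
  obtain ⟨x1, x2⟩ := key x hx
  obtain ⟨y1, y2⟩ := key y hy
  simp only [orient, crossProd] at *
  refine Prod.ext (mul_left_cancel₀ h ?_) (mul_left_cancel₀ h ?_)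
  · linear_combination (q'.1 - p'.1) * (x1 - y1) - (q.1 - p.1) * (x2 - y2)
  · linear_combination (q'.2 - p'.2) * (x1 - y1) - (q.2 - p.2) * (x2 - y2)

/-- The height of `x` over the side `u v` of a triangle, normalized to be `1` at the apex `a`. -/
def triHeight (u v a x : ℝ × ℝ) : ℝ := orient u v x / orient u v a

/-- The affine function with values `0`, `2`, `1` at the corners `u`, `v`, `a` of a triangle. -/
def triWidth (u v a x : ℝ × ℝ) : ℝ := (orient u v x - 2 * orient u a x) / orient u v a

section Triangle

variable {u v a : ℝ × ℝ}

lemma triHeight_combo {r s : ℝ} (h : r + s = 1) (x y : ℝ × ℝ) :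
    triHeight u v a (r • x + s • y) = r * triHeight u v a x + s * triHeight u v a y := by
  simp only [triHeight, orient_combo h]
  ring

lemma triWidth_combo {r s : ℝ} (h : r + s = 1) (x y : ℝ × ℝ) :
    triWidth u v a (r • x + s • y) = r * triWidth u v a x + s * triWidth u v a y := by
  simp only [triWidth, orient_combo h]
  ring

lemma tri_ext (h : orient u v a ≠ 0) {x y : ℝ × ℝ} (h1 : triHeight u v a x = triHeight u v a y)
    (h2 : triWidth u v a x = triWidth u v a y) : x = y := by
  rw [triHeight, triHeight, div_left_inj' h] at h1
  rw [triWidth, triWidth, div_left_inj' h] at h2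
  have h3 : orient u a x = orient u a y := by linarith
  simp only [orient] at *
  refine Prod.ext (mul_left_cancel₀ h ?_) (mul_left_cancel₀ h ?_)
  · linear_combination (a.1 - u.1) * h1 - (v.1 - u.1) * h3
  · linear_combination (a.2 - u.2) * h1 - (v.2 - u.2) * h3

/-- The point at a given height on the median of a triangle. -/
def medianPoint (u v a : ℝ × ℝ) (h : ℝ) : ℝ × ℝ :=
  ((1 - h) / 2) • u + ((1 - h) / 2) • v + h • a

@[simp] lemma triHeight_left : triHeight u v a u = 0 := by simp [triHeight, orient]

@[simp] lemma triHeight_right : triHeight u v a v = 0 := by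
  simp only [triHeight, orient]; ring

@[simp] lemma triWidth_left : triWidth u v a u = 0 := by simp [triWidth, orient]

lemma triWidth_right (h : orient u v a ≠ 0) : triWidth u v a v = 2 := by
  rw [triWidth, div_eq_iff h]
  simp only [orient]
  ring

lemma orient_medianPoint (p q : ℝ × ℝ) (h : ℝ) : orient p q (medianPoint u v a h) =
    (1 - h) / 2 * (orient p q u + orient p q v) + h * orient p q a := by
  simp only [orient, medianPoint, Prod.fst_add, Prod.snd_add, Prod.smul_fst, Prod.smul_snd,
    smul_eq_mul]
  ring

lemma crossProd_medianPoint (p q : ℝ × ℝ) (h : ℝ) : crossProd (medianPoint u v a h) u p q =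
    -((1 - h) / 2 * crossProd u v p q + h * crossProd u a p q) := by
  simp only [crossProd, medianPoint, Prod.fst_add, Prod.snd_add, Prod.smul_fst, Prod.smul_snd,
    smul_eq_mul]
  ring

lemma triHeight_medianPoint (ho : orient u v a ≠ 0) (h : ℝ) :
    triHeight u v a (medianPoint u v a h) = h := by
  rw [triHeight, div_eq_iff ho, orient_medianPoint]
  simp only [orient]
  ring

lemma triWidth_medianPoint (ho : orient u v a ≠ 0) (h : ℝ) :
    triWidth u v a (medianPoint u v a h) = 1 := by
  rw [triWidth, div_eq_iff ho, orient_medianPoint, orient_medianPoint]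
  simp only [orient]
  ring

end Triangle

end Orientation

section Layout

/-- `a` is an end of the base edge `k`. -/
abbrev IsEnd (k : Fin 16) (a : Fin 11) : Prop := a = bundleSrc k ∨ a = bundleTgt k

/-- The triangle spanned by a base edge and an apex. -/
def layoutTri (P : Fin 11 → ℤ × ℤ) (A : Fin 16 → ℤ × ℤ) (k : Fin 16) : Fin 3 → ℤ × ℤ :=
  ![P (bundleSrc k), P (bundleTgt k), A k]

/-- The line `p q` separates two triples of points up to a common end of two base edges. -/
def Separates (P : Fin 11 → ℤ × ℤ) (k l : Fin 16) (s t : Fin 3 → ℤ × ℤ) (p q : ℤ × ℤ) : Prop :=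
  p ≠ q ∧ (∀ i, orient p q (s i) ≤ 0) ∧ ((∀ j, 0 < orient p q (t j)) ∨
    ∃ c, IsEnd k c ∧ IsEnd l c ∧ orient p q (P c) = 0 ∧ ∀ j, 0 < orient p q (t j) ∨ t j = P c)

instance (P : Fin 11 → ℤ × ℤ) (k l : Fin 16) (s t : Fin 3 → ℤ × ℤ) (p q : ℤ × ℤ) :
    Decidable (Separates P k l s t p q) := by
  unfold Separates; infer_instance

/-- Integral positions of the base vertices, together with an apex for every base edge such that
its bundle can be drawn in the triangle over the edge, and the pairs of triangles that meet. -/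
structure Layout where
  P : Fin 11 → ℤ × ℤ
  A : Fin 16 → ℤ × ℤ
  cr : Fin 16 → Fin 16 → Bool
  P_injective : ∀ a b, P a = P b → a = b
  nondegenerate : ∀ k < 12, orient (P (bundleSrc k)) (P (bundleTgt k)) (A k) ≠ 0
  thin : ∀ k ≥ 12, A k = P (bundleTgt k)
  cr_symm : ∀ k l, cr k l = cr l k
  cr_irrefl : ∀ k, cr k k = false
  cr_thin : ∀ k l, cr k l = true → k < 12 → 12 ≤ l
  separated : ∀ k l, k < l → cr k l = false → ∃ i j,
    Separates P k l (layoutTri P A k) (layoutTri P A l) (layoutTri P A k i) (layoutTri P A k j) ∨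
    Separates P k l (layoutTri P A k) (layoutTri P A l) (layoutTri P A l i) (layoutTri P A l j) ∨
    Separates P k l (layoutTri P A l) (layoutTri P A k) (layoutTri P A k i) (layoutTri P A k j) ∨
    Separates P k l (layoutTri P A l) (layoutTri P A k) (layoutTri P A l i) (layoutTri P A l j)
  transverse : ∀ k l, cr k l = true → 12 ≤ l →
    0 < crossProd (P (bundleSrc k)) (P (bundleTgt k)) (P (bundleSrc l)) (P (bundleTgt l)) *
      crossProd (P (bundleSrc k)) (A k) (P (bundleSrc l)) (P (bundleTgt l))
  half : ∀ k l, cr k l = true → k < 12 → ∃ i j,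
    (∀ r, 0 ≤ orient (layoutTri P A l i) (layoutTri P A l j) (layoutTri P A l r)) ∧
    orient (layoutTri P A l i) (layoutTri P A l j) (P (bundleTgt k)) < 0 ∧
    orient (layoutTri P A l i) (layoutTri P A l j) (A k) < 0 ∧
    orient (layoutTri P A l i) (layoutTri P A l j) (P (bundleSrc k)) +
      orient (layoutTri P A l i) (layoutTri P A l j) (P (bundleTgt k)) < 0
  no_triple : ∀ k l j, cr k l = true → cr l j = true → cr k j = true →
    12 ≤ k ∧ 12 ≤ l ∧ 12 ≤ j ∧
      lineDet (P (bundleSrc k)) (P (bundleTgt k)) (P (bundleSrc l)) (P (bundleTgt l))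
        (P (bundleSrc j)) (P (bundleTgt j)) ≠ 0
  free : ∀ a k, ∃ l < 12, l ≠ k ∧ IsEnd l a ∧ cr k l = false

/-- The layout with the unbundled edges drawn as long diagonals of a decagon. -/
def diagonalLayout : Layout where
  P := ![(-10, 0), (-6, 5), (-2, 7), (3, 7), (6, 4), (10, 0), (7, -5), (2, -8), (-3, -6), (-7, -4),
    (0, 30)]
  A := ![(-7, 2), (-4, 5), (0, 6), (4, 5), (7, 1), (8, -2), (4, -6), (0, -6), (-5, -4), (-8, -1),
    (-4, 15), (6, 15), (7, -5), (2, -8), (-3, -6), (-7, -4)]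
  cr k l := decide (12 ≤ k ∧ 12 ≤ l ∧ k ≠ l)
  P_injective := by decide +kernel
  nondegenerate := by decide +kernel
  thin := by decide +kernel
  cr_symm := by decide +kernel
  cr_irrefl := by decide +kernel
  cr_thin := by decide +kernel
  separated := by decide +kernel
  transverse := by decide +kernel
  half := by decide +kernel
  no_triple := by decide +kernel
  free := by decide +kernel

/-- The layout with one of the unbundled edges drawn across a bundle. -/
def oneGapLayout : Layout where
  P := ![(-30, 0), (-15, 30), (3, 33), (15, 30), (60, -30), (30, 0), (21, -15), (12, -18), (-3, -12),
    (-15, -30), (0, -90)]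
  A := ![(-23, 15), (-6, 32), (9, 32), (38, 1), (44, -16), (26, -8), (17, -17), (4, -16), (-8, -22),
    (-23, -15), (-14, -45), (16, -45), (21, -15), (12, -18), (-3, -12), (-15, -30)]
  cr k l := decide (k ≠ l ∧ (12 ≤ k ∧ k < 15 ∧ 12 ≤ l ∧ l < 15 ∨ k = 11 ∧ l = 15 ∨ k = 15 ∧ l = 11))
  P_injective := by decide +kernel
  nondegenerate := by decide +kernel
  thin := by decide +kernel
  cr_symm := by decide +kernel
  cr_irrefl := by decide +kernel
  cr_thin := by decide +kernel
  separated := by decide +kernel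
  transverse := by decide +kernel
  half := by decide +kernel
  no_triple := by decide +kernel
  free := by decide +kernel

end Layout

section StrandHeight

variable {m : ℕ}

/-- The height of a middle vertex over its base edge. -/
def strandHeight (w : Fin m) : ℝ := 1 / ((w / 12 : ℕ) + 1)

lemma strandHeight_pos (w : Fin m) : 0 < strandHeight w := by unfold strandHeight; positivity

lemma strandHeight_le_one (w : Fin m) : strandHeight w ≤ 1 := by
  unfold strandHeight
  rw [div_le_one (by positivity)]
  linarith [Nat.cast_nonneg (α := ℝ) (w / 12 : ℕ)]

lemma eq_of_strandHeight_eq {w w' : Fin m} (hl : strandLabel w = strandLabel w')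
    (hh : strandHeight w = strandHeight w') : w = w' := by
  rw [strandHeight, strandHeight, one_div, one_div, inv_inj, add_left_inj, Nat.cast_inj] at hh
  have hl := Fin.val_eq_of_eq hl
  simp only [strandLabel] at hl
  omega

lemma strandLabel_lt (w : Fin m) : strandLabel w < 12 := Fin.lt_def.2 (Nat.mod_lt _ (by norm_num))

end StrandHeight

namespace Layout

variable (L : Layout) {m : ℕ}

/-- The position of a base vertex. -/
def basePos (a : Fin 11) : ℝ × ℝ := toPlane (L.P a)

/-- The apex of the triangle over a base edge. -/
def apex (k : Fin 16) : ℝ × ℝ := toPlane (L.A k)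

/-- The position of the first end of a base edge. -/
def src (k : Fin 16) : ℝ × ℝ := L.basePos (bundleSrc k)

/-- The position of the second end of a base edge. -/
def tgt (k : Fin 16) : ℝ × ℝ := L.basePos (bundleTgt k)

/-- The position of a vertex. -/
def pos : BundleVertex m → ℝ × ℝ
  | Sum.inl a => L.basePos a
  | Sum.inr w => medianPoint (L.src (strandLabel w)) (L.tgt (strandLabel w))
      (L.apex (strandLabel w)) (strandHeight w)

/-- The segment representing an edge. -/
def seg (e : BundleEdge m) : Set (ℝ × ℝ) := segment ℝ (L.pos (edgeFst e)) (L.pos (edgeSnd e))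

/-- The triangle over a base edge. -/
def region (k : Fin 16) : Set (ℝ × ℝ) :=
  convexHull ℝ (range fun i => toPlane (layoutTri L.P L.A k i))

variable {L}

lemma basePos_injective : Function.Injective L.basePos := fun a b h =>
  L.P_injective a b (toPlane_injective h)

lemma src_mem_region (k : Fin 16) : L.src k ∈ L.region k := subset_convexHull _ _ ⟨0, rfl⟩

lemma tgt_mem_region (k : Fin 16) : L.tgt k ∈ L.region k := subset_convexHull _ _ ⟨1, rfl⟩

lemma apex_mem_region (k : Fin 16) : L.apex k ∈ L.region k := subset_convexHull _ _ ⟨2, rfl⟩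

lemma basePos_mem_region {k : Fin 16} {a : Fin 11} (h : IsEnd k a) : L.basePos a ∈ L.region k := by
  rcases h with rfl | rfl
  exacts [src_mem_region k, tgt_mem_region k]

lemma region_subset {k : Fin 16} {S : Set (ℝ × ℝ)} (hS : Convex ℝ S)
    (h : ∀ i, toPlane (layoutTri L.P L.A k i) ∈ S) : L.region k ⊆ S :=
  convexHull_min (range_subset_iff.2 h) hS

lemma pos_mem_region (w : Fin m) : L.pos (Sum.inr w) ∈ L.region (strandLabel w) := by
  have h0 := strandHeight_pos w
  have h1 := strandHeight_le_one w
  have hc : Convex ℝ (L.region (strandLabel w)) := convex_convexHull _ _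
  have half : (0 : ℝ) ≤ 1 / 2 := by norm_num
  convert hc (hc (src_mem_region _) (tgt_mem_region _) half half (by norm_num))
    (apex_mem_region _) (sub_nonneg.2 h1) h0.le (by ring) using 1
  simp only [pos, medianPoint]
  module

lemma seg_subset_region : ∀ e : BundleEdge m, L.seg e ⊆ L.region (edgeLabel e)
  | Sum.inl k => (convex_convexHull _ _).segment_subset (src_mem_region k) (tgt_mem_region k)
  | Sum.inr (w, false) => (convex_convexHull _ _).segment_subset (pos_mem_region w)
      (src_mem_region _)
  | Sum.inr (w, true) => (convex_convexHull _ _).segment_subset (pos_mem_region w)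
      (tgt_mem_region _)

lemma eq_of_separates {k l : Fin 16} {s t : Fin 3 → ℤ × ℤ} {p q : ℤ × ℤ}
    (h : Separates L.P k l s t p q) {x : ℝ × ℝ}
    (hs : x ∈ convexHull ℝ (range fun i => toPlane (s i)))
    (ht : x ∈ convexHull ℝ (range fun i => toPlane (t i))) :
    ∃ c, IsEnd k c ∧ IsEnd l c ∧ x = L.basePos c := by
  have hx : orient (toPlane p) (toPlane q) x ≤ 0 := by
    refine convexHull_min (range_subset_iff.2 fun i => ?_) (convex_orient_nonpos _ _) hs
    simp only [mem_ofPred_eq, orient_toPlane]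
    exact_mod_cast h.2.1 i
  rcases h.2.2 with h | ⟨c, hk, hl, hc, h⟩
  · refine absurd hx (not_le.2 (convexHull_min (range_subset_iff.2 fun i => ?_)
      (convex_orient_pos (toPlane p) (toPlane q)) ht))
    simp only [mem_ofPred_eq, orient_toPlane]
    exact_mod_cast h i
  · have hc' : orient (toPlane p) (toPlane q) (toPlane (L.P c)) = 0 := by
      rw [orient_toPlane, hc, Int.cast_zero]
    refine ⟨c, hk, hl, (convexHull_min (range_subset_iff.2 fun i => ?_)
      (convex_orient_pos_or_eq hc') ht).resolve_left hx.not_gt⟩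
    simp only [mem_ofPred_eq, orient_toPlane]
    exact (h i).imp (fun h => by exact_mod_cast h) (congrArg toPlane)

lemma eq_of_mem_region {k l : Fin 16} (hkl : k ≠ l) (hcr : L.cr k l = false) {x : ℝ × ℝ}
    (hk : x ∈ L.region k) (hl : x ∈ L.region l) :
    ∃ c, IsEnd k c ∧ IsEnd l c ∧ x = L.basePos c := by
  rcases lt_or_gt_of_ne hkl with h | h
  · obtain ⟨i, j, h | h | h | h⟩ := L.separated k l h hcr
    exacts [eq_of_separates h hk hl, eq_of_separates h hk hl, eq_of_separates h hl hk,
      eq_of_separates h hl hk]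
  · obtain ⟨i, j, h⟩ := L.separated l k h (by rwa [L.cr_symm])
    suffices ∃ c, IsEnd l c ∧ IsEnd k c ∧ x = L.basePos c by
      obtain ⟨c, h₁, h₂, h₃⟩ := this
      exact ⟨c, h₂, h₁, h₃⟩
    rcases h with h | h | h | h
    exacts [eq_of_separates h hl hk, eq_of_separates h hl hk, eq_of_separates h hk hl,
      eq_of_separates h hk hl]

variable (L) in
/-- The height of a point over a base edge. -/
def height (k : Fin 16) (x : ℝ × ℝ) : ℝ := triHeight (L.src k) (L.tgt k) (L.apex k) x

variable (L) in
/-- The coordinate of a point along a base edge. -/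
def width (k : Fin 16) (x : ℝ × ℝ) : ℝ := triWidth (L.src k) (L.tgt k) (L.apex k) x

lemma orient_ne_zero {k : Fin 16} (hk : k < 12) : orient (L.src k) (L.tgt k) (L.apex k) ≠ 0 := by
  rw [src, tgt, apex, basePos, basePos, orient_toPlane]
  exact_mod_cast L.nondegenerate k hk

lemma ext_height_width {k : Fin 16} (hk : k < 12) {x y : ℝ × ℝ}
    (h : L.height k x = L.height k y) (h' : L.width k x = L.width k y) : x = y :=
  tri_ext (orient_ne_zero hk) h h'

lemma height_src (k : Fin 16) : L.height k (L.src k) = 0 := triHeight_left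

lemma height_tgt (k : Fin 16) : L.height k (L.tgt k) = 0 := triHeight_right

lemma width_src (k : Fin 16) : L.width k (L.src k) = 0 := triWidth_left

lemma width_tgt {k : Fin 16} (hk : k < 12) : L.width k (L.tgt k) = 2 :=
  triWidth_right (orient_ne_zero hk)

lemma height_basePos {k : Fin 16} {a : Fin 11} (h : IsEnd k a) : L.height k (L.basePos a) = 0 := by
  rcases h with rfl | rfl
  exacts [height_src k, height_tgt k]

lemma height_pos (w : Fin m) : L.height (strandLabel w) (L.pos (Sum.inr w)) = strandHeight w :=
  triHeight_medianPoint (orient_ne_zero (strandLabel_lt w)) _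

lemma width_pos (w : Fin m) : L.width (strandLabel w) (L.pos (Sum.inr w)) = 1 :=
  triWidth_medianPoint (orient_ne_zero (strandLabel_lt w)) _

/-- The image of an edge in the coordinates of its triangle. -/
def OnEdge (e : BundleEdge m) (h t : ℝ) : Prop :=
  match e with
  | Sum.inl _ => h = 0
  | Sum.inr (w, false) => t ≤ 1 ∧ h = strandHeight w * t
  | Sum.inr (w, true) => 1 ≤ t ∧ h = strandHeight w * (2 - t)

lemma onEdge_of_mem_seg {e : BundleEdge m} {x : ℝ × ℝ} (hx : x ∈ L.seg e) :
    OnEdge e (L.height (edgeLabel e) x) (L.width (edgeLabel e) x) := by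
  obtain ⟨r, s, hr, hs, hrs, rfl⟩ := hx
  rcases e with k | ⟨w, _ | _⟩
  · change L.height k _ = 0
    rw [height, triHeight_combo hrs]
    change r * L.height k (L.src k) + s * L.height k (L.tgt k) = 0
    rw [height_src, height_tgt]
    ring
  · change L.width (strandLabel w) _ ≤ 1 ∧ L.height (strandLabel w) _ = _ *
      L.width (strandLabel w) _
    rw [height, width, triHeight_combo hrs, triWidth_combo hrs]
    change r * L.width (strandLabel w) (L.pos (Sum.inr w)) + s * L.width (strandLabel w) (L.src _)
      ≤ 1 ∧ r * L.height (strandLabel w) (L.pos (Sum.inr w)) +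
        s * L.height (strandLabel w) (L.src _) = strandHeight w *
          (r * L.width (strandLabel w) (L.pos (Sum.inr w)) + s * L.width (strandLabel w) (L.src _))
    rw [height_pos, width_pos, height_src, width_src]
    constructor
    · linarith
    · ring
  · change 1 ≤ L.width (strandLabel w) _ ∧ L.height (strandLabel w) _ = _ *
      (2 - L.width (strandLabel w) _)
    rw [height, width, triHeight_combo hrs, triWidth_combo hrs]
    change 1 ≤ r * L.width (strandLabel w) (L.pos (Sum.inr w)) +
        s * L.width (strandLabel w) (L.tgt _) ∧ r * L.height (strandLabel w) (L.pos (Sum.inr w)) +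
        s * L.height (strandLabel w) (L.tgt _) = strandHeight w * (2 -
          (r * L.width (strandLabel w) (L.pos (Sum.inr w)) + s * L.width (strandLabel w) (L.tgt _)))
    rw [height_pos, width_pos, height_tgt, width_tgt (strandLabel_lt w)]
    constructor
    · linarith
    · linear_combination (2 * strandHeight w) * hrs

variable (L) in
/-- The edges which may cross. -/
def MayCross (e f : BundleEdge m) : Prop :=
  L.cr (edgeLabel e) (edgeLabel f) = true ∧ (∀ w, e ≠ Sum.inr (w, true)) ∧
    ∀ w, f ≠ Sum.inr (w, true)

lemma MayCross.symm {e f : BundleEdge m} (h : L.MayCross e f) : L.MayCross f e :=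
  ⟨by rw [L.cr_symm]; exact h.1, h.2.2, h.2.1⟩

lemma mem_edgeSym_of_isEnd {e : BundleEdge m} {c : Fin 11} (hc : IsEnd (edgeLabel e) c)
    (he : L.basePos c ∈ L.seg e) : Sum.inl c ∈ edgeSym e := by
  have h := onEdge_of_mem_seg he
  rcases e with k | ⟨w, _ | _⟩
  · rcases hc with rfl | rfl
    exacts [Sym2.mem_mk_left _ _, Sym2.mem_mk_right _ _]
  · have hw := strandHeight_pos w
    rcases hc with rfl | rfl
    · exact Sym2.mem_mk_right _ _
    · have h : L.width (strandLabel w) (L.tgt (strandLabel w)) ≤ 1 := h.1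
      rw [width_tgt (strandLabel_lt w)] at h
      norm_num at h
  · rcases hc with rfl | rfl
    · have h : 1 ≤ L.width (strandLabel w) (L.src (strandLabel w)) := h.1
      rw [width_src] at h
      norm_num at h
    · exact Sym2.mem_mk_right _ _

lemma eq_src {k : Fin 16} (hk : k < 12) {x : ℝ × ℝ} (h : L.height k x = 0)
    (h' : L.width k x = 0) : x = L.pos (m := m) (Sum.inl (bundleSrc k)) :=
  ext_height_width hk (h.trans (height_src k).symm) (h'.trans (width_src k).symm)

lemma eq_tgt {k : Fin 16} (hk : k < 12) {x : ℝ × ℝ} (h : L.height k x = 0)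
    (h' : L.width k x = 2) : x = L.pos (m := m) (Sum.inl (bundleTgt k)) :=
  ext_height_width hk (h.trans (height_tgt k).symm) (h'.trans (width_tgt hk).symm)

/-- Two edges of the same bundle meet only at common ends. -/
lemma exists_eq_pos_of_edgeLabel_eq {e f : BundleEdge m} (hef : e ≠ f)
    (hl : edgeLabel e = edgeLabel f) {x : ℝ × ℝ} (he : x ∈ L.seg e) (hf : x ∈ L.seg f) :
    ∃ c ∈ edgeSym e, c ∈ edgeSym f ∧ x = L.pos c := by
  wlog hle : (Sum.elim (fun _ => 0) (fun p => p.2.toNat + 1) e : ℕ) ≤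
    Sum.elim (fun _ => 0) (fun p => p.2.toNat + 1) f generalizing e f
  · obtain ⟨c, h₁, h₂, h₃⟩ := this hef.symm hl.symm hf he (le_of_not_ge hle)
    exact ⟨c, h₂, h₁, h₃⟩
  have hE := onEdge_of_mem_seg he
  have hF := onEdge_of_mem_seg hf
  rw [← hl] at hF
  set b := L.height (edgeLabel e) x with hb
  set t := L.width (edgeLabel e) x with ht
  rcases e with k | ⟨w, _ | _⟩ <;> rcases f with l | ⟨w', _ | _⟩ <;>
    simp only [OnEdge] at hE hF <;> simp only [edgeLabel] at hl hb ht <;>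
    simp only [Sum.elim_inl, Sum.elim_inr, Bool.toNat_true, Bool.toNat_false] at hle <;>
    try omega
  · exact absurd (congrArg Sum.inl hl) hef
  · obtain rfl := hl
    have h0 : t = 0 := by
      rw [hE] at hF
      exact (mul_eq_zero.1 hF.2.symm).resolve_left (strandHeight_pos w').ne'
    exact ⟨_, Sym2.mem_mk_left _ _, Sym2.mem_mk_right _ _,
      eq_src (strandLabel_lt w') (hb.symm.trans hE) (ht.symm.trans h0)⟩
  · obtain rfl := hl
    have h0 : t = 2 := by
      rw [hE] at hF
      linarith [(mul_eq_zero.1 hF.2.symm).resolve_left (strandHeight_pos w').ne']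
    exact ⟨_, Sym2.mem_mk_right _ _, Sym2.mem_mk_right _ _,
      eq_tgt (strandLabel_lt w') (hb.symm.trans hE) (ht.symm.trans h0)⟩
  · have h0 : t = 0 := by
      have h : (strandHeight w - strandHeight w') * t = 0 := by linarith
      refine (mul_eq_zero.1 h).resolve_left fun h => hef ?_
      rw [eq_of_strandHeight_eq hl (sub_eq_zero.1 h)]
    refine ⟨Sum.inl (bundleSrc (strandLabel w)), Sym2.mem_mk_right _ _, ?_,
      eq_src (strandLabel_lt w)     (hb.symm.trans (by rw [hE.2, h0, mul_zero])) (ht.symm.trans h0)⟩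
    rw [hl]
    exact Sym2.mem_mk_right _ _
  · have h1 : t = 1 := le_antisymm hE.1 hF.1
    obtain rfl : w = w' := eq_of_strandHeight_eq hl (by linarith [hE.2, hF.2, h1 ▸ hE.2, h1 ▸ hF.2])
    refine ⟨Sum.inr w, Sym2.mem_mk_left _ _, Sym2.mem_mk_left _ _,
      ext_height_width (L := L) (strandLabel_lt w) ?_ ?_⟩
    · rw [← hb, height_pos, hE.2, h1, mul_one]
    · rw [← ht, width_pos, h1]
  · have h2 : t = 2 := by
      have h : (strandHeight w - strandHeight w') * (2 - t) = 0 := by linarith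
      refine (sub_eq_zero.1 ((mul_eq_zero.1 h).resolve_left fun h => hef ?_)).symm
      rw [eq_of_strandHeight_eq hl (sub_eq_zero.1 h)]
    refine ⟨Sum.inl (bundleTgt (strandLabel w)), Sym2.mem_mk_right _ _, ?_,
      eq_tgt (strandLabel_lt w)     (hb.symm.trans (by rw [hE.2, h2, sub_self, mul_zero])) (ht.symm.trans h2)⟩
    rw [hl]
    exact Sym2.mem_mk_right _ _

lemma not_mem_region_of_cr {w : Fin m} {l : Fin 16} (h : L.cr (strandLabel w) l = true)
    {x : ℝ × ℝ} (hx : x ∈ L.seg (Sum.inr (w, true))) : x ∉ L.region l := by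
  obtain ⟨i, j, h₁, h₂, h₃, h₄⟩ := L.half _ l h (strandLabel_lt w)
  set p := toPlane (layoutTri L.P L.A l i) with hp
  set q := toPlane (layoutTri L.P L.A l j) with hq
  have h0 := strandHeight_pos w
  have h1 := strandHeight_le_one w
  have h₂' : orient p q (L.tgt (strandLabel w)) < 0 := by
    rw [tgt, basePos, orient_toPlane]; exact_mod_cast h₂
  have h₃' : orient p q (L.apex (strandLabel w)) < 0 := by
    rw [apex, orient_toPlane]; exact_mod_cast h₃
  have h₄' : orient p q (L.src (strandLabel w)) + orient p q (L.tgt (strandLabel w)) < 0 := by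
    rw [tgt, src, basePos, basePos, orient_toPlane, orient_toPlane]; exact_mod_cast h₄
  intro hxl
  have hx0 : 0 ≤ orient p q x := by
    refine region_subset (convex_orient_nonneg p q) (fun r => ?_) hxl
    simp only [mem_ofPred_eq, hp, hq, orient_toPlane]
    exact_mod_cast h₁ r
  obtain ⟨r, s, hr, hs, hrs, rfl⟩ := hx
  have hm : orient p q (L.pos (Sum.inr w)) < 0 := by
    rw [pos, orient_medianPoint]
    nlinarith
  change 0 ≤ orient p q (r • L.pos (Sum.inr w) + s • L.tgt (strandLabel w)) at hx0
  rw [orient_combo hrs] at hx0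
  rcases hr.eq_or_lt with rfl | hr
  · nlinarith
  · nlinarith

/-- Two edges which may not cross meet only at common ends. -/
lemma exists_eq_pos {e f : BundleEdge m} (hef : e ≠ f) (hc : ¬ L.MayCross e f) {x : ℝ × ℝ}
    (he : x ∈ L.seg e) (hf : x ∈ L.seg f) : ∃ c ∈ edgeSym e, c ∈ edgeSym f ∧ x = L.pos c := by
  by_cases hl : edgeLabel e = edgeLabel f
  · exact exists_eq_pos_of_edgeLabel_eq hef hl he hf
  cases hcr : L.cr (edgeLabel e) (edgeLabel f)
  · obtain ⟨c, h₁, h₂, rfl⟩ :=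
      eq_of_mem_region hl hcr (seg_subset_region e he) (seg_subset_region f hf)
    exact ⟨Sum.inl c, mem_edgeSym_of_isEnd h₁ he, mem_edgeSym_of_isEnd h₂ hf, rfl⟩
  · exfalso
    refine hc ⟨hcr, ?_, ?_⟩
    · rintro w rfl
      exact not_mem_region_of_cr hcr he (seg_subset_region f hf)
    · rintro w rfl
      rw [L.cr_symm] at hcr
      exact not_mem_region_of_cr hcr hf (seg_subset_region e he)

lemma pos_inl_ne_inr (a : Fin 11) (w : Fin m) : L.pos (m := m) (Sum.inl a) ≠ L.pos (Sum.inr w) := by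
  intro h
  obtain ⟨l, -, hl, ha, hcr⟩ := L.free a (strandLabel w)
  obtain ⟨c, hc, -, hx⟩ := eq_of_mem_region hl.symm hcr (pos_mem_region w)
    (h ▸ basePos_mem_region (L := L) ha)
  have := height_basePos (L := L) hc
  rw [← hx, height_pos] at this
  exact (strandHeight_pos w).ne' this

lemma pos_injective : Function.Injective (L.pos (m := m)) := by
  rintro (a | w) (b | w') h
  · rw [basePos_injective h]
  · exact absurd h (pos_inl_ne_inr a w')
  · exact absurd h.symm (pos_inl_ne_inr b w)
  · have hw : L.pos (Sum.inr w) ∈ L.region (strandLabel w') := h ▸ pos_mem_region w'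
    by_cases hl : strandLabel w = strandLabel w'
    · rw [eq_of_strandHeight_eq hl]
      rw [← height_pos (L := L), ← height_pos (L := L), ← hl, h]
    · cases hcr : L.cr (strandLabel w) (strandLabel w')
      · obtain ⟨c, hc, -, hx⟩ := eq_of_mem_region hl hcr (pos_mem_region w) hw
        have := height_basePos (L := L) hc
        rw [← hx, height_pos] at this
        exact absurd this (strandHeight_pos w).ne'
      · exact absurd (strandLabel_lt w') (L.cr_thin _ _ hcr (strandLabel_lt w)).not_gt

lemma mem_edgeSym_of_pos_mem {e : BundleEdge m} {c : BundleVertex m} (h : L.pos c ∈ L.seg e) :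
    c ∈ edgeSym e := by
  suffices ∃ f, (c ∈ edgeSym f) ∧ ¬ L.MayCross e f by
    obtain ⟨f, hf, hef⟩ := this
    rcases eq_or_ne e f with rfl | hne
    · exact hf
    · have hcf : L.pos c ∈ L.seg f := by
        rcases Sym2.mem_iff.1 hf with rfl | rfl
        exacts [left_mem_segment _ _ _, right_mem_segment _ _ _]
      obtain ⟨c', h₁, -, h₃⟩ := exists_eq_pos hne hef h hcf
      rwa [pos_injective h₃]
  rcases c with a | w
  · obtain ⟨l, -, -, ha, hcr⟩ := L.free a (edgeLabel e)
    refine ⟨Sum.inl l, ?_, fun h => by simpa using hcr.symm.trans h.1⟩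
    rcases ha with rfl | rfl
    exacts [Sym2.mem_mk_left _ _, Sym2.mem_mk_right _ _]
  · exact ⟨Sum.inr (w, true), Sym2.mem_mk_left _ _, fun h => h.2.2 w rfl⟩

lemma eq_inl_of_le_edgeLabel {e : BundleEdge m} (h : 12 ≤ edgeLabel e) :
    e = Sum.inl (edgeLabel e) := by
  rcases e with k | ⟨w, b⟩
  · rfl
  · exact absurd (strandLabel_lt w) h.not_gt

lemma seg_subsingleton {e f : BundleEdge m} (h : L.MayCross e f) :
    (L.seg e ∩ L.seg f).Subsingleton := by
  wlog hf : 12 ≤ edgeLabel f generalizing e f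
  · rw [inter_comm]
    exact this h.symm (L.cr_thin _ _ h.symm.1 (not_le.1 hf))
  have ht := L.transverse _ _ h.1 hf
  rw [eq_inl_of_le_edgeLabel hf]
  set l := edgeLabel f
  refine segment_inter_subsingleton ?_
  have key : 0 < crossProd (L.src (edgeLabel e)) (L.tgt (edgeLabel e)) (L.src l) (L.tgt l) *
      crossProd (L.src (edgeLabel e)) (L.apex (edgeLabel e)) (L.src l) (L.tgt l) := by
    simp only [src, tgt, apex, basePos, crossProd_toPlane]
    exact_mod_cast ht
  rcases e with k | ⟨w, _ | _⟩
  · exact left_ne_zero_of_mul key.ne'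
  · change 0 < crossProd (L.src (strandLabel w)) (L.tgt (strandLabel w)) _ _ *
      crossProd (L.src (strandLabel w)) (L.apex (strandLabel w)) _ _ at key
    change crossProd (medianPoint (L.src (strandLabel w)) (L.tgt (strandLabel w))
      (L.apex (strandLabel w)) (strandHeight w)) (L.src (strandLabel w)) (L.src l) (L.tgt l) ≠ 0
    rw [crossProd_medianPoint]
    have h0 := strandHeight_pos w
    have h1 := strandHeight_le_one w
    intro hz
    have hz' := congrArg (· * crossProd (L.src (strandLabel w)) (L.tgt (strandLabel w)) (L.src l)
      (L.tgt l)) hz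
    simp only [zero_mul] at hz'
    set c := crossProd (L.src (strandLabel w)) (L.tgt (strandLabel w)) (L.src l) (L.tgt l)
    set d := crossProd (L.src (strandLabel w)) (L.apex (strandLabel w)) (L.src l) (L.tgt l)
    have h2 : 0 < strandHeight w * (c * d) := by positivity
    nlinarith [mul_nonneg (sub_nonneg.2 h1) (sq_nonneg c)]
  · exact absurd rfl (h.2.1 w)

lemma seg_eq_of_edgeSym_eq {e : BundleEdge m} {u v : BundleVertex m} (h : edgeSym e = s(u, v)) :
    segment ℝ (L.pos u) (L.pos v) = L.seg e := by
  rcases Sym2.eq_iff.1 h with ⟨rfl, rfl⟩ | ⟨rfl, rfl⟩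
  · rfl
  · exact segment_symm ..

lemma mayCross_of_mem {e f : BundleEdge m} (hef : e ≠ f) {x : ℝ × ℝ}
    (hx : x ∉ range (L.pos (m := m))) (he : x ∈ L.seg e) (hf : x ∈ L.seg f) : L.MayCross e f := by
  by_contra h
  obtain ⟨c, -, -, rfl⟩ := exists_eq_pos hef h he hf
  exact hx ⟨c, rfl⟩

variable (L m) in
/-- The straight-line drawing of the bundle graph given by a layout. -/
def drawing : Drawing (bundleGraph m) := by
  refine straightDrawing _ L.pos pos_injective ?_ ?_ ?_
  · intro u v w h hw
    obtain ⟨e, he⟩ := bundleGraph_adj.1 h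
    rw [seg_eq_of_edgeSym_eq he] at hw
    rw [← Sym2.mem_iff, ← he]
    exact mem_edgeSym_of_pos_mem hw
  · intro u v w z h h' hne
    obtain ⟨e, he⟩ := bundleGraph_adj.1 h
    obtain ⟨f, hf⟩ := bundleGraph_adj.1 h'
    rw [seg_eq_of_edgeSym_eq he, seg_eq_of_edgeSym_eq hf]
    by_cases hc : L.MayCross e f
    · exact (seg_subsingleton hc).finite
    · refine (finite_range (L.pos (m := m))).subset fun x hx => ?_
      obtain ⟨c, -, -, rfl⟩ :=
        exists_eq_pos (by rintro rfl; exact hne (he.symm.trans hf)) hc hx.1 hx.2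
      exact ⟨c, rfl⟩
  · rintro x hx u₁ v₁ u₂ v₂ u₃ v₃ h₁ h₂ h₃ h₁₂ h₁₃ h₂₃ ⟨hx₁, hx₂, hx₃⟩
    obtain ⟨e, he⟩ := bundleGraph_adj.1 h₁
    obtain ⟨f, hf⟩ := bundleGraph_adj.1 h₂
    obtain ⟨g, hg⟩ := bundleGraph_adj.1 h₃
    rw [seg_eq_of_edgeSym_eq he] at hx₁
    rw [seg_eq_of_edgeSym_eq hf] at hx₂
    rw [seg_eq_of_edgeSym_eq hg] at hx₃
    have hef : L.MayCross e f :=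
      mayCross_of_mem (by rintro rfl; exact h₁₂ (he.symm.trans hf)) hx hx₁ hx₂
    have hfg : L.MayCross f g :=
      mayCross_of_mem (by rintro rfl; exact h₂₃ (hf.symm.trans hg)) hx hx₂ hx₃
    have heg : L.MayCross e g :=
      mayCross_of_mem (by rintro rfl; exact h₁₃ (he.symm.trans hg)) hx hx₁ hx₃
    obtain ⟨le, lf, lg, hdet⟩ := L.no_triple _ _ _ hef.1 hfg.1 heg.1
    rw [eq_inl_of_le_edgeLabel le] at hx₁
    rw [eq_inl_of_le_edgeLabel lf] at hx₂
    rw [eq_inl_of_le_edgeLabel lg] at hx₃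
    have h0 := lineDet_eq_zero_of_mem_segment hx₁ hx₂ hx₃
    simp only [pos, basePos, edgeFst, edgeSnd, lineDet_toPlane] at h0
    exact hdet (by exact_mod_cast h0)

lemma img_drawing (e : BundleEdge m) : (L.drawing m).img (edgeSym e) = L.seg e :=
  (segment_eq_image_lineMap _ _ _).symm

lemma exists_mayCross_of_crossing {E F : Sym2 (BundleVertex m)} {x : ℝ × ℝ}
    (h : (L.drawing m).Crossing E F x) : ∃ e f, E = edgeSym e ∧ F = edgeSym f ∧ L.MayCross e f ∧
      x ∈ L.seg e ∩ L.seg f := by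
  obtain ⟨hE, hF, hne, hxE, hxF, hx⟩ := h
  rw [edgeSet_bundleGraph] at hE hF
  obtain ⟨e, rfl⟩ := hE
  obtain ⟨f, rfl⟩ := hF
  rw [img_drawing] at hxE hxF
  exact ⟨e, f, rfl, rfl, mayCross_of_mem (fun h => hne (congrArg _ h)) hx hxE hxF, hxE, hxF⟩

end Layout

/-- The diagonal layout has at most one crossing for each pair of unbundled edges. -/
lemma crossings_diagonalLayout_le (m : ℕ) : (diagonalLayout.drawing m).crossings ≤ 6 := by
  set S : Finset (Fin 16 × Fin 16) := Finset.univ.filter fun p => 12 ≤ p.1 ∧ p.1 < p.2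
  have hS : S.card = 6 := by decide
  have key : ∀ x ∈ (diagonalLayout.drawing m).crossingSet, ∃ p ∈ S,
      x ∈ diagonalLayout.seg (m := m) (Sum.inl p.1) ∩
        diagonalLayout.seg (m := m) (Sum.inl p.2) := by
    rintro x ⟨E, F, h⟩
    obtain ⟨e, f, -, -, hc, he, hf⟩ := Layout.exists_mayCross_of_crossing h
    obtain ⟨h₁, h₂, hne⟩ : 12 ≤ edgeLabel e ∧ 12 ≤ edgeLabel f ∧ edgeLabel e ≠ edgeLabel f :=
      of_decide_eq_true hc.1
    rw [Layout.eq_inl_of_le_edgeLabel h₁] at he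
    rw [Layout.eq_inl_of_le_edgeLabel h₂] at hf
    rcases lt_or_gt_of_ne hne with h | h
    · exact ⟨(edgeLabel e, edgeLabel f), by simp [S, h₁, h], he, hf⟩
    · exact ⟨(edgeLabel f, edgeLabel e), by simp [S, h₂, h], hf, he⟩
  choose! p hp hx using key
  rw [← hS, ← ncard_coe_finset]
  refine ncard_le_ncard_of_injOn p hp (fun x hxs y hys hxy => ?_)
  have hcr : diagonalLayout.MayCross (m := m) (Sum.inl (p x).1) (Sum.inl (p x).2) := by
    have h := hp x hxs
    simp only [S, Finset.mem_filter, Finset.mem_univ, true_and] at h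
    exact ⟨decide_eq_true ⟨h.1, h.1.trans h.2.le, h.2.ne⟩, by simp, by simp⟩
  exact Layout.seg_subsingleton hcr (hx x hxs) (hxy ▸ hx y hys)

/-- In the one-gap layout, the crossings of `k` and `l` are assigned to `k`. -/
def Owns (k l : Fin 16) : Prop :=
  k = 11 ∧ l = 15 ∨ k = 12 ∧ l = 13 ∨ k = 13 ∧ l = 14 ∨ k = 14 ∧ l = 12

lemma isKGapPlanar_oneGapLayout (m : ℕ) : (oneGapLayout.drawing m).IsKGapPlanar 1 := by
  have hown : ∀ k l, oneGapLayout.cr k l = true → Owns k l ∨ Owns l k := by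
    unfold Owns; decide +kernel
  have hle : ∀ k l, Owns k l → 12 ≤ l := by unfold Owns; decide
  have huniq : ∀ k l l', Owns k l → Owns k l' → l = l' := by unfold Owns; decide
  have key : ∀ x ∈ (oneGapLayout.drawing m).crossingSet, ∃ e f : BundleEdge m,
      Owns (edgeLabel e) (edgeLabel f) ∧
        (oneGapLayout.drawing m).Crossing (edgeSym e) (edgeSym f) x ∧
        oneGapLayout.MayCross e f ∧ x ∈ oneGapLayout.seg e ∩ oneGapLayout.seg f := by
    rintro x ⟨E, F, h⟩
    obtain ⟨e, f, rfl, rfl, hc, hx⟩ := Layout.exists_mayCross_of_crossing h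
    rcases hown _ _ hc.1 with ho | ho
    · exact ⟨e, f, ho, h, hc, hx⟩
    · exact ⟨f, e, ho, ⟨h.2.1, h.1, h.2.2.1.symm, h.2.2.2.2.1, h.2.2.2.1, h.2.2.2.2.2⟩, hc.symm,
        hx.symm⟩
  choose! e f ho hc hm hx using key
  refine ⟨fun x => edgeSym (e x), fun x hxs => ⟨_, hc x hxs⟩, fun E => ?_⟩
  refine (ncard_le_one ((Drawing.crossingSet_finite _).subset fun x hx => hx.1)).2 ?_
  rintro x ⟨hxs, rfl⟩ y ⟨hys, hxy⟩
  have he : e y = e x := edgeSym_injective hxy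
  have hl := huniq _ _ _ (ho x hxs) (he ▸ ho y hys)
  have hf : f y = f x := by
    rw [Layout.eq_inl_of_le_edgeLabel (hle _ _ (ho x hxs)),
      Layout.eq_inl_of_le_edgeLabel (hle _ _ (ho y hys)), hl]
  exact Layout.seg_subsingleton (hm x hxs) (hx x hxs) (he ▸ hf ▸ hx y hys)

lemma Drawing.isKGapPlanar_of_crossings_eq_zero {V : Type} [Finite V] {G : SimpleGraph V}
    {Γ : Drawing G} (h : Γ.crossings = 0) (e₀ : Sym2 V) (k : ℕ) : Γ.IsKGapPlanar k := by
  have h0 : Γ.crossingSet = ∅ := (ncard_eq_zero Γ.crossingSet_finite).1 h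
  refine ⟨fun _ => e₀, ?_, ?_⟩ <;> simp [h0]

lemma exists_oneGapPlanar_graph {ℓ : ℕ} (hℓ : 2 ≤ ℓ) : ∃ G : SimpleGraph (Fin (16 * ℓ - 7)),
    (∃ Γ : Drawing G, Γ.IsKGapPlanar 1) ∧ ℓ ≤ crNumRestricted G (fun Γ => Γ.IsKGapPlanar 1) ∧
      1 ≤ crNum G ∧ crNum G ≤ 6 := by
  obtain ⟨m, hn, hm⟩ : ∃ m, 16 * ℓ - 7 = 11 + m ∧ 12 * (ℓ - 1) ≤ m :=
    ⟨16 * ℓ - 18, by omega, by omega⟩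
  rw [hn]
  let φ : BundleVertex m ≃ Fin (11 + m) := finSumFinEquiv
  let G : SimpleGraph (Fin (11 + m)) := (bundleGraph m).comap φ.symm
  have hto : ∀ u v, G.Adj u v → (bundleGraph m).Adj (φ.symm.toEmbedding u) (φ.symm.toEmbedding v) :=
    fun u v h => h
  have hfrom : ∀ u v, (bundleGraph m).Adj u v → G.Adj (φ.toEmbedding u) (φ.toEmbedding v) :=
    fun u v h => by simpa [G] using h
  have hgap : ∃ Γ : Drawing G, Γ.IsKGapPlanar 1 := by
    have : Nonempty (Fin (11 + m)) := ⟨φ (Sum.inl 0)⟩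
    exact ⟨_, (isKGapPlanar_oneGapLayout m).comap φ.symm.toEmbedding hto⟩
  have hlow : ∀ Γ : Drawing G, Γ.IsKGapPlanar 1 → ℓ ≤ Γ.crossings := fun Γ hΓ => by
    have : Nonempty (BundleVertex m) := ⟨Sum.inl 0⟩
    exact (le_crossings_bundleGraph hm _ (hΓ.comap φ.toEmbedding hfrom)).trans
      (Drawing.crossings_comap_le Γ _ _)
  refine ⟨G, hgap, ?_, ?_, ?_⟩
  · obtain ⟨Γ, hΓ, h⟩ := exists_crossings_eq_crNumRestricted hgap
    exact h ▸ hlow Γ hΓ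
  · obtain ⟨Γ, h⟩ := exists_crossings_eq_crNum hgap.nonempty
    by_contra! h0
    have h0 : Γ.crossings = 0 := by omega
    have := hlow Γ (Γ.isKGapPlanar_of_crossings_eq_zero h0 s(φ (Sum.inl 0), φ (Sum.inl 0)) 1)
    omega
  · exact (crNum_le ((diagonalLayout.drawing m).comap φ.symm.toEmbedding hto)).trans
      ((Drawing.crossings_comap_le _ _ _).trans (crossings_diagonalLayout_le m))

/-- For every `ℓ ≥ 2` there exists a 1-gap-planar simple
graph on exactly `n = 16ℓ - 7` vertices with `cr_{1-gap}(G) ≥ ℓ` and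
`cr(G) ≤ 6`; moreover the 1-gap-planar crossing ratio is `Θ(n)`. -/
theorem one_gap_planar_crossing_ratio (ℓ : ℕ) (hℓ : 2 ≤ ℓ) :
    (∃ G : SimpleGraph (Fin (16 * ℓ - 7)),
      (∃ Γ : Drawing G, Γ.IsKGapPlanar 1) ∧
      ℓ ≤ crNumRestricted G (fun Γ => Γ.IsKGapPlanar 1) ∧
      crNum G ≤ 6) ∧
    -- the 1-gap-planar crossing ratio is O(n):
    (∃ c : ℝ, 0 < c ∧ ∀ (n : ℕ) (G : SimpleGraph (Fin n)),
      (∃ Γ : Drawing G, Γ.IsKGapPlanar 1) → 1 ≤ crNum G →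
      (crNumRestricted G (fun Γ => Γ.IsKGapPlanar 1) : ℝ) ≤ c * n * crNum G) ∧
    -- the 1-gap-planar crossing ratio is Ω(n):
    (∃ c : ℝ, 0 < c ∧ ∀ N : ℕ, ∃ n, N ≤ n ∧ ∃ G : SimpleGraph (Fin n),
      (∃ Γ : Drawing G, Γ.IsKGapPlanar 1) ∧ 1 ≤ crNum G ∧
      c * n * crNum G ≤ (crNumRestricted G (fun Γ => Γ.IsKGapPlanar 1) : ℝ)) := by
  refine ⟨?_, ⟨17, by norm_num, fun n G h h1 => ?_⟩, 1 / 96, by norm_num, fun N => ?_⟩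
  · obtain ⟨G, h₁, h₂, -, h₃⟩ := exists_oneGapPlanar_graph hℓ
    exact ⟨G, h₁, h₂, h₃⟩
  · exact_mod_cast crNumRestricted_oneGap_le n G h h1
  · obtain ⟨G, h₁, h₂, h₃, h₄⟩ := exists_oneGapPlanar_graph (Nat.le_add_left 2 N)
    refine ⟨16 * (N + 2) - 7, by omega, G, h₁, h₃, ?_⟩
    have hn : ((16 * (N + 2) - 7 : ℕ) : ℝ) ≤ 16 * (N + 2 : ℕ) := by
      exact_mod_cast Nat.sub_le _ _
    have h₂ : ((N + 2 : ℕ) : ℝ) ≤ crNumRestricted G (fun Γ => Γ.IsKGapPlanar 1) := by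
      exact_mod_cast h₂
    have h₄ : (crNum G : ℝ) ≤ 6 := by exact_mod_cast h₄
    have := mul_le_mul hn h₄ (Nat.cast_nonneg _) (by positivity)
    linarith
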